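/- arXiv:2409.00907 — 2 statements merged into one kernel-verified Lean document; each statement's English description precedes it below -/
import Mathlib

section
/- For every integer d ≥ 1, there exists a coherent orientation on the triangulated disc Δ_d (a triangulation of a 2-disc with 3d boundary vertices and 3d - 2 triangles) such that exactly 2d - 1 triangles are positive, exactly d - 1 triangles are negative, and every boundary edge of Δ_d lies in a positive triangle. -/
open Finset

/-- An abstract simplicial complex on vertex type `V`: a collection of nonempty
finite sets of vertices closed under taking nonempty subsets. -/
structure AbsCx (V : Type*) where
  faces : Set (Finset V)
  down_closed : ∀ ⦃s t : Finset V⦄, s ∈ faces → t ⊆ s → t.Nonempty → t ∈ faces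
  nonempty_of_mem : ∀ ⦃s⦄, s ∈ faces → s.Nonempty

namespace AbsCx

variable {V W : Type*}

/-- The vertices of a complex. -/
def vertexSet (K : AbsCx V) : Set V := {v | {v} ∈ K.faces}

/-- The `n`-dimensional faces (given by `n+1` vertices). -/
def facetsOfDim (K : AbsCx V) (n : ℕ) : Set (Finset V) :=
  {s | s ∈ K.faces ∧ s.card = n + 1}

/-- A simplicial map sends faces to faces. -/
def IsSimplicialMap [DecidableEq W] (K : AbsCx V) (L : AbsCx W) (f : V → W) : Prop :=
  ∀ s ∈ K.faces, s.image f ∈ L.faces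

/-- Geometric realization of an abstract simplicial complex, as a subspace of `V → ℝ`. -/
def realization (K : AbsCx V) : Set (V → ℝ) :=
  {g | (∀ v, 0 ≤ g v) ∧ ∃ s ∈ K.faces, (∀ v, v ∉ s → g v = 0) ∧ ∑ v ∈ s, g v = 1}

/-- `K` is a triangulation of the `n`-sphere. -/
def IsSphereTriangulation (n : ℕ) (K : AbsCx V) : Prop :=
  Nonempty (K.realization ≃ₜ Metric.sphere (0 : EuclideanSpace ℝ (Fin (n+1))) 1)

/-- `K` is a triangulation of the closed `n`-disc. -/
def IsDiscTriangulation (n : ℕ) (K : AbsCx V) : Prop :=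
  Nonempty (K.realization ≃ₜ Metric.closedBall (0 : EuclideanSpace ℝ (Fin n)) 1)

/-- `K` triangulates a closed (compact, boundaryless = locally Euclidean) topological
`n`-manifold. -/
def IsClosedManifoldTriangulation (n : ℕ) (K : AbsCx V) : Prop :=
  ∃ (M : Type) (ts : TopologicalSpace M),
    @CompactSpace M ts ∧ Nonempty (@ChartedSpace (EuclideanSpace ℝ (Fin n)) _ M ts) ∧
      Nonempty (@Homeomorph (K.realization) M _ ts)

/-- A coherent orientation of the `n`-dimensional faces of `K`: a sign function on
ordered `(n+1)`-tuples of vertices, alternating under permutations, equal to `±1`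
exactly on the orderings of `n`-faces, and such that two facets sharing an
`(n-1)`-face (i.e. orderings differing in exactly one coordinate) get opposite signs. -/
structure CoherentOrientation [DecidableEq V] (n : ℕ) (K : AbsCx V) where
  sign : (Fin (n+1) → V) → ℤ
  sign_perm : ∀ (x : Fin (n+1) → V) (σ : Equiv.Perm (Fin (n+1))),
    sign (x ∘ σ) = (Equiv.Perm.sign σ : ℤ) * sign x
  sign_unit : ∀ x : Fin (n+1) → V, Function.Injective x →
    Finset.image x Finset.univ ∈ K.faces → sign x = 1 ∨ sign x = -1
  sign_zero : ∀ x : Fin (n+1) → V,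
    ¬ Function.Injective x ∨ Finset.image x Finset.univ ∉ K.faces → sign x = 0
  coherent : ∀ x y : Fin (n+1) → V,
    (∃ i, x i ≠ y i ∧ ∀ j, j ≠ i → x j = y j) →
    sign x ≠ 0 → sign y ≠ 0 → sign y = - sign x

open scoped Classical in
/-- The algebraic number of preimages of the ordered simplex `y` under `f`. -/
noncomputable def algSum [Fintype V] {n : ℕ}
    (sgn : (Fin (n+1) → V) → ℤ) (f : V → W) (y : Fin (n+1) → W) : ℤ :=
  ∑ x : Fin (n+1) → V, if f ∘ x = y then sgn x else 0

/-- `f` has degree `d`: the algebraic number of preimages of every positively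
oriented facet of the target equals `d`. -/
def HasDegree [Fintype V] [DecidableEq V] [DecidableEq W] {n : ℕ}
    {K : AbsCx V} {L : AbsCx W}
    (oK : CoherentOrientation n K) (oL : CoherentOrientation n L)
    (f : V → W) (d : ℤ) : Prop :=
  ∀ y : Fin (n+1) → W, oL.sign y = 1 → algSum oK.sign f y = d

/-- The standard `n`-sphere `S^n_{n+2}`: the boundary complex of the `(n+1)`-simplex,
i.e. all proper nonempty subsets of `n+2` vertices. -/
def stdSphere (n : ℕ) : AbsCx (Fin (n+2)) where
  faces := {s | s.Nonempty ∧ s ≠ Finset.univ}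
  down_closed := fun {s t} hs hts ht =>
    ⟨ht, fun h => hs.2 (Finset.univ_subset_iff.mp (h ▸ hts))⟩
  nonempty_of_mem := fun {s} hs => hs.1

/-- Boundary edges of a 2-dimensional complex: edges lying in exactly one triangle. -/
def boundaryEdges (K : AbsCx V) : Set (Finset V) :=
  {e | e ∈ K.faces ∧ e.card = 2 ∧ Set.ncard {s | s ∈ K.faces ∧ s.card = 3 ∧ e ⊆ s} = 1}

end AbsCx

open AbsCx

/-- The triangles positively oriented under a coherent orientation, where the sign of a
triangle is computed on its increasing vertex ordering. -/
def posTriangles {V : Type*} [LinearOrder V] {de : DecidableEq V} {K : AbsCx V}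
    (o : @CoherentOrientation V de 2 K) : Set (Finset V) :=
  {s | ∃ x : Fin 3 → V, StrictMono x ∧ Finset.image x Finset.univ = s ∧ o.sign x = 1}

/-- The negatively oriented triangles. -/
def negTriangles {V : Type*} [LinearOrder V] {de : DecidableEq V} {K : AbsCx V}
    (o : @CoherentOrientation V de 2 K) : Set (Finset V) :=
  {s | ∃ x : Fin 3 → V, StrictMono x ∧ Finset.image x Finset.univ = s ∧ o.sign x = -1}

/-- complex generated by a set of finsets -/
def cxOf {V : Type*} (T : Set (Finset V)) : AbsCx V where
  faces := {s | s.Nonempty ∧ ∃ t ∈ T, s ⊆ t}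
  down_closed := fun _ _ hs hts ht =>
    ⟨ht, hs.2.choose, hs.2.choose_spec.1, hts.trans hs.2.choose_spec.2⟩
  nonempty_of_mem := fun _ hs => hs.1

lemma mem_real {V : Type*} [Fintype V] (T : Set (Finset V)) (g : V → ℝ) :
    g ∈ (cxOf T).realization ↔
      (∀ v, 0 ≤ g v) ∧ ∑ v, g v = 1 ∧ ∃ t ∈ T, ∀ v, v ∉ t → g v = 0 := by
  constructor
  · rintro ⟨h0, s, ⟨hs, t, ht, hst⟩, hz, hsum⟩
    refine ⟨h0, ?_, t, ht, fun v hv => hz v (fun h => hv (hst h))⟩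
    rw [← hsum]
    symm
    exact Finset.sum_subset (Finset.subset_univ _) (fun v _ hv => hz v hv)
  · rintro ⟨h0, hsum, t, ht, hz⟩
    have h1 : ∑ v ∈ t, g v = 1 := by
      rw [← hsum]
      exact Finset.sum_subset (Finset.subset_univ _) (fun v _ hv => hz v hv)
    refine ⟨h0, t, ⟨?_, t, ht, subset_rfl⟩, hz, h1⟩
    by_contra h
    rw [Finset.not_nonempty_iff_eq_empty] at h
    simp [h] at h1

section ear
variable {V : Type*} [DecidableEq V]

/-- collapse the ear -/
noncomputable def earF (u v w x : V) (g : V → ℝ) : V → ℝ := fun y =>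
  g y + (if y = u then (g x - min (g u) (g v)) / 2 else 0)
    + (if y = v then (g x - min (g u) (g v)) / 2 else 0)
    + (if y = w then min (g u) (g v) else 0) + (if y = x then - g x else 0)

/-- expand the ear -/
noncomputable def earG (u v w x : V) (g : V → ℝ) : V → ℝ := fun y =>
  g y + (if y = u then min (g w) (2 * min (g u) (g v)) - min (g u) (g v) else 0)
    + (if y = v then min (g w) (2 * min (g u) (g v)) - min (g u) (g v) else 0)
    + (if y = w then - min (g w) (2 * min (g u) (g v)) else 0)
    + (if y = x then 2 * min (g u) (g v) - min (g w) (2 * min (g u) (g v)) else 0)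

lemma earF_cont (u v w x : V) : Continuous (earF u v w x) := by
  unfold earF
  refine continuous_pi fun y => ?_
  split_ifs <;> fun_prop

lemma earG_cont (u v w x : V) : Continuous (earG u v w x) := by
  unfold earG
  refine continuous_pi fun y => ?_
  split_ifs <;> fun_prop

lemma earF_sum [Fintype V] (u v w x : V) (g : V → ℝ) : ∑ y, earF u v w x g y = ∑ y, g y := by
  simp only [earF, Finset.sum_add_distrib, Finset.sum_ite_eq', Finset.mem_univ, if_true]
  ring

lemma earG_sum [Fintype V] (u v w x : V) (g : V → ℝ) : ∑ y, earG u v w x g y = ∑ y, g y := by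
  simp only [earG, Finset.sum_add_distrib, Finset.sum_ite_eq', Finset.mem_univ, if_true]
  ring

lemma ear_homeo [Fintype V] (T : Set (Finset V)) (u v w x : V)
    (huv : u ≠ v) (huw : u ≠ w) (hvw : v ≠ w) (hT : {u, v, w} ∈ T)
    (hx : ∀ t ∈ T, x ∉ t) (hu : ∀ t ∈ T, u ∈ t → v ∈ t → t = {u, v, w}) :
    Nonempty ((cxOf (insert {u, v, x} T)).realization ≃ₜ (cxOf T).realization) := by
  have hxu : x ≠ u := fun h => hx _ hT (by simp [h])
  have hxv : x ≠ v := fun h => hx _ hT (by simp [h])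
  have hxw : x ≠ w := fun h => hx _ hT (by simp [h])
  have evF : ∀ g, earF u v w x g u = g u + (g x - min (g u) (g v)) / 2 ∧
      earF u v w x g v = g v + (g x - min (g u) (g v)) / 2 ∧
      earF u v w x g w = g w + min (g u) (g v) ∧ earF u v w x g x = 0 ∧
      ∀ y, y ≠ u → y ≠ v → y ≠ w → y ≠ x → earF u v w x g y = g y := by
    intro g
    refine ⟨?_, ?_, ?_, ?_, ?_⟩
    · simp [earF, huv, huw, hxu.symm]
    · simp [earF, huv.symm, hvw, hxv.symm]
    · simp [earF, huw.symm, hvw.symm, hxw.symm]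
    · simp [earF, hxu, hxv, hxw]
    · intro y h1 h2 h3 h4
      simp [earF, h1, h2, h3, h4]
  have evG : ∀ g, earG u v w x g u = g u + (min (g w) (2 * min (g u) (g v)) - min (g u) (g v)) ∧
      earG u v w x g v = g v + (min (g w) (2 * min (g u) (g v)) - min (g u) (g v)) ∧
      earG u v w x g w = g w - min (g w) (2 * min (g u) (g v)) ∧
      earG u v w x g x = g x + (2 * min (g u) (g v) - min (g w) (2 * min (g u) (g v))) ∧
      ∀ y, y ≠ u → y ≠ v → y ≠ w → y ≠ x → earG u v w x g y = g y := by
    intro g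
    refine ⟨?_, ?_, ?_, ?_, ?_⟩
    · simp [earG, huv, huw, hxu.symm]
    · simp [earG, huv.symm, hvw, hxv.symm]
    · simp [earG, huw.symm, hvw.symm, hxw.symm]; ring
    · simp [earG, hxu, hxv, hxw]
    · intro y h1 h2 h3 h4
      simp [earG, h1, h2, h3, h4]
  have mF : ∀ g ∈ (cxOf (insert {u, v, x} T)).realization,
      earF u v w x g ∈ (cxOf T).realization := by
    intro g hg
    rw [mem_real] at hg ⊢
    obtain ⟨h0, hs, t, ht, hz⟩ := hg
    rw [earF_sum]
    obtain ⟨e1, e2, e3, e4, e5⟩ := evF g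
    have n1 := h0 u
    have n2 := h0 v
    have n3 := h0 w
    have n4 := h0 x
    refine ⟨fun y => ?_, hs, ?_⟩
    · by_cases y1 : y = u
      · subst y1; rw [e1]; rcases min_cases (g y) (g v) with h | h <;> linarith
      by_cases y2 : y = v
      · subst y2; rw [e2]; rcases min_cases (g u) (g y) with h | h <;> linarith
      by_cases y3 : y = w
      · subst y3; rw [e3]; rcases min_cases (g u) (g v) with h | h <;> linarith
      by_cases y4 : y = x
      · subst y4; rw [e4]
      rw [e5 y y1 y2 y3 y4]; exact h0 y
    · by_cases hc : t = {u, v, x} ∨ t = {u, v, w}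
      · refine ⟨_, hT, fun y hy => ?_⟩
        simp only [Finset.mem_insert, Finset.mem_singleton, not_or] at hy
        obtain ⟨y1, y2, y3⟩ := hy
        by_cases y4 : y = x
        · subst y4; rw [e4]
        rw [e5 y y1 y2 y3 y4]
        apply hz
        rcases hc with rfl | rfl <;> simp [y1, y2, y3, y4]
      · push Not at hc
        have htT : t ∈ T := by
          rcases ht with h | h
          · exact absurd h hc.1
          · exact h
        have hgx : g x = 0 := hz x (hx t htT)
        have hm : min (g u) (g v) = 0 := by
          by_cases hut : u ∈ t
          · have : v ∉ t := fun h => hc.2 (hu t htT hut h)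
            rw [hz v this]; exact min_eq_right n1
          · rw [hz u hut]; exact min_eq_left n2
        refine ⟨t, htT, fun y hy => ?_⟩
        have : earF u v w x g y = g y := by
          simp [earF, hgx, hm]
        rw [this]; exact hz y hy
  have mG : ∀ g ∈ (cxOf T).realization,
      earG u v w x g ∈ (cxOf (insert {u, v, x} T)).realization := by
    intro g hg
    rw [mem_real] at hg ⊢
    obtain ⟨h0, hs, t, ht, hz⟩ := hg
    rw [earG_sum]
    obtain ⟨e1, e2, e3, e4, e5⟩ := evG g
    have n1 := h0 u
    have n2 := h0 v
    have n3 := h0 w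
    have hgx : g x = 0 := hz x (hx t ht)
    refine ⟨fun y => ?_, hs, ?_⟩
    · by_cases y1 : y = u
      · subst y1; rw [e1]
        rcases min_cases (g y) (g v) with h | h <;>
        rcases min_cases (g w) (2 * min (g y) (g v)) with h' | h' <;> linarith
      by_cases y2 : y = v
      · subst y2; rw [e2]
        rcases min_cases (g u) (g y) with h | h <;>
        rcases min_cases (g w) (2 * min (g u) (g y)) with h' | h' <;> linarith
      by_cases y3 : y = w
      · subst y3; rw [e3]
        rcases min_cases (g y) (2 * min (g u) (g v)) with h' | h' <;> linarith
      by_cases y4 : y = x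
      · subst y4; rw [e4]
        rcases min_cases (g w) (2 * min (g u) (g v)) with h' | h' <;> linarith
      rw [e5 y y1 y2 y3 y4]; exact h0 y
    · by_cases hc : t = {u, v, w}
      · rcases le_total (g w) (2 * min (g u) (g v)) with hle | hle
        · rw [min_eq_left hle] at e3
          refine ⟨_, Set.mem_insert _ _, fun y hy => ?_⟩
          simp only [Finset.mem_insert, Finset.mem_singleton, not_or] at hy
          obtain ⟨y1, y2, y4⟩ := hy
          by_cases y3 : y = w
          · subst y3; rw [e3]; ring
          rw [e5 y y1 y2 y3 y4]
          apply hz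
          simp [hc, y1, y2, y3]
        · rw [min_eq_right hle] at e4
          refine ⟨_, Set.mem_insert_of_mem _ hT, fun y hy => ?_⟩
          simp only [Finset.mem_insert, Finset.mem_singleton, not_or] at hy
          obtain ⟨y1, y2, y3⟩ := hy
          by_cases y4 : y = x
          · subst y4; rw [e4, hgx]; ring
          rw [e5 y y1 y2 y3 y4]
          apply hz
          simp [hc, y1, y2, y3]
      · have hm : min (g u) (g v) = 0 := by
          by_cases hut : u ∈ t
          · have : v ∉ t := fun h => hc (hu t ht hut h)
            rw [hz v this]; exact min_eq_right n1
          · rw [hz u hut]; exact min_eq_left n2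
        refine ⟨t, Set.mem_insert_of_mem _ ht, fun y hy => ?_⟩
        have : earG u v w x g y = g y := by
          simp [earG, hm, n3]
        rw [this]; exact hz y hy
  refine ⟨{ toFun := fun g => ⟨earF u v w x g.1, mF _ g.2⟩
            invFun := fun g => ⟨earG u v w x g.1, mG _ g.2⟩
            left_inv := ?_
            right_inv := ?_
            continuous_toFun := ?_
            continuous_invFun := ?_ }⟩
  · rintro ⟨g, hg⟩
    apply Subtype.ext
    change earG u v w x (earF u v w x g) = g
    rw [mem_real] at hg
    obtain ⟨h0, hs, t, ht, hz⟩ := hg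
    have hmin : min (g w) (g x) = 0 := by
      rcases ht with h | h
      · rw [hz w (by rw [h]; simp [huw.symm, hvw.symm, hxw.symm])]
        exact min_eq_left (h0 x)
      · rw [hz x (hx t h)]; exact min_eq_right (h0 w)
    obtain ⟨e1, e2, e3, e4, e5⟩ := evF g
    obtain ⟨f1, f2, f3, f4, f5⟩ := evG (earF u v w x g)
    have k1 : min (earF u v w x g u) (earF u v w x g v) = (min (g u) (g v) + g x) / 2 := by
      rw [e1, e2, min_add_add_right]; ring
    have k2 : min (earF u v w x g w) (2 * min (earF u v w x g u) (earF u v w x g v))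
        = min (g u) (g v) := by
      rw [k1, e3]
      have : 2 * ((min (g u) (g v) + g x) / 2) = g x + min (g u) (g v) := by ring
      rw [this, min_add_add_right, hmin, zero_add]
    rw [k2, k1] at f1 f2 f4
    rw [k2] at f3
    funext y
    by_cases y1 : y = u
    · subst y1; rw [f1, e1]; ring
    by_cases y2 : y = v
    · subst y2; rw [f2, e2]; ring
    by_cases y3 : y = w
    · subst y3; rw [f3, e3]; ring
    by_cases y4 : y = x
    · subst y4; rw [f4, e4]; ring
    rw [f5 y y1 y2 y3 y4, e5 y y1 y2 y3 y4]
  · rintro ⟨g, hg⟩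
    apply Subtype.ext
    change earF u v w x (earG u v w x g) = g
    rw [mem_real] at hg
    obtain ⟨h0, hs, t, ht, hz⟩ := hg
    have hgx : g x = 0 := hz x (hx t ht)
    obtain ⟨e1, e2, e3, e4, e5⟩ := evG g
    obtain ⟨f1, f2, f3, f4, f5⟩ := evF (earG u v w x g)
    have k1 : min (earG u v w x g u) (earG u v w x g v) = min (g w) (2 * min (g u) (g v)) := by
      rw [e1, e2, min_add_add_right]; ring
    rw [k1] at f1 f2 f3
    funext y
    by_cases y1 : y = u
    · subst y1; rw [f1, e1, e4, hgx]; ring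
    by_cases y2 : y = v
    · subst y2; rw [f2, e2, e4, hgx]; ring
    by_cases y3 : y = w
    · subst y3; rw [f3, e3]; ring
    by_cases y4 : y = x
    · subst y4; rw [f4, hgx]
    rw [f5 y y1 y2 y3 y4, e5 y y1 y2 y3 y4]
  · exact ((earF_cont u v w x).comp continuous_subtype_val).subtype_mk _
  · exact ((earG_cont u v w x).comp continuous_subtype_val).subtype_mk _

end ear

section base
variable {V : Type*} [DecidableEq V]

lemma base_disc [Fintype V] (u v w : V) (huv : u ≠ v) (huw : u ≠ w) (hvw : v ≠ w) :
    (cxOf ({{u, v, w}} : Set (Finset V))).IsDiscTriangulation 2 := by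
  set S : Set (EuclideanSpace ℝ (Fin 2)) := {p | 0 ≤ p 0 ∧ 0 ≤ p 1 ∧ p 0 + p 1 ≤ 1} with hS
  have hconv : Convex ℝ S := by
    rintro p ⟨h1, h2, h3⟩ q ⟨k1, k2, k3⟩ a b ha hb hab
    refine ⟨?_, ?_, ?_⟩ <;> simp only [PiLp.add_apply, PiLp.smul_apply, smul_eq_mul]
    · positivity
    · positivity
    · nlinarith
  have c0 : Continuous (fun p : EuclideanSpace ℝ (Fin 2) => p 0) := by fun_prop
  have c1 : Continuous (fun p : EuclideanSpace ℝ (Fin 2) => p 1) := by fun_prop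
  have hclosed : IsClosed S :=
    (isClosed_le continuous_const c0).inter ((isClosed_le continuous_const c1).inter
      (isClosed_le (c0.add c1) continuous_const))
  have hint : (interior S).Nonempty := by
    refine ⟨!₂[1/4, 1/4], mem_interior.2 ⟨{p | 0 < p 0 ∧ 0 < p 1 ∧ p 0 + p 1 < 1}, ?_, ?_, ?_⟩⟩
    · rintro p ⟨h1, h2, h3⟩
      exact ⟨h1.le, h2.le, h3.le⟩
    · exact (isOpen_lt continuous_const c0).inter ((isOpen_lt continuous_const c1).inter
        (isOpen_lt (c0.add c1) continuous_const))
    · refine ⟨?_, ?_, ?_⟩ <;> norm_num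
  have hbdd : Bornology.IsBounded S := by
    refine (Metric.isBounded_closedBall (x := (0 : EuclideanSpace ℝ (Fin 2))) (r := 2)).subset ?_
    rintro p ⟨h1, h2, h3⟩
    rw [mem_closedBall_zero_iff, EuclideanSpace.norm_eq, Real.sqrt_le_iff]
    refine ⟨by norm_num, ?_⟩
    simp only [Fin.sum_univ_two, Real.norm_eq_abs, sq_abs]
    nlinarith
  obtain ⟨h, -, hh, -⟩ :=
    exists_homeomorph_image_interior_closure_frontier_eq_unitBall hconv hint hbdd
  rw [hclosed.closure_eq] at hh
  have hsum : ∀ g : V → ℝ, (∀ y, y ∉ ({u, v, w} : Finset V) → g y = 0) →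
      ∑ y, g y = g u + g v + g w := by
    intro g hg
    rw [← Finset.sum_subset (Finset.subset_univ {u, v, w}) (fun y _ hy => hg y hy)]
    rw [Finset.sum_insert (by simp [huv, huw]), Finset.sum_pair hvw]; ring
  have m1 : ∀ g ∈ (cxOf ({{u, v, w}} : Set (Finset V))).realization,
      (!₂[g u, g v] : EuclideanSpace ℝ (Fin 2)) ∈ S := by
    intro g hg
    rw [mem_real] at hg
    obtain ⟨h0, hs, t, ht, hz⟩ := hg
    rw [Set.mem_singleton_iff] at ht
    subst ht
    rw [hsum g hz] at hs
    have := h0 w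
    refine ⟨by simpa using h0 u, by simpa using h0 v, ?_⟩
    simp
    linarith
  let inv : EuclideanSpace ℝ (Fin 2) → V → ℝ := fun p y =>
    if y = u then p 0 else if y = v then p 1 else if y = w then 1 - p 0 - p 1 else 0
  have m2 : ∀ p ∈ S, inv p ∈ (cxOf ({{u, v, w}} : Set (Finset V))).realization := by
    rintro p ⟨h1, h2, h3⟩
    rw [mem_real]
    have hz : ∀ y, y ∉ ({u, v, w} : Finset V) → inv p y = 0 := by
      intro y hy
      simp only [Finset.mem_insert, Finset.mem_singleton, not_or] at hy
      simp [inv, hy.1, hy.2.1, hy.2.2]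
    refine ⟨fun y => ?_, ?_, _, rfl, hz⟩
    · simp only [inv]
      split_ifs <;> linarith
    · rw [hsum _ hz]
      simp only [inv, huv.symm, huw.symm, hvw.symm, if_true, if_false]
      ring
  have e1 : (cxOf ({{u, v, w}} : Set (Finset V))).realization ≃ₜ S :=
    { toFun := fun g => ⟨!₂[g.1 u, g.1 v], m1 _ g.2⟩
      invFun := fun p => ⟨inv p.1, m2 _ p.2⟩
      left_inv := by
        rintro ⟨g, hg⟩
        apply Subtype.ext
        funext y
        rw [mem_real] at hg
        obtain ⟨h0, hs, t, ht, hz⟩ := hg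
        rw [Set.mem_singleton_iff] at ht
        subst ht
        rw [hsum g hz] at hs
        simp only [inv]
        split_ifs with y1 y2 y3
        · subst y1; simp
        · subst y2; simp
        · subst y3; simp; linarith
        · exact (hz y (by simp [y1, y2, y3])).symm
      right_inv := by
        rintro ⟨p, hp⟩
        apply Subtype.ext
        ext i
        fin_cases i
        · simp [inv]
        · simp [inv, huv.symm]
      continuous_toFun := by
        refine Continuous.subtype_mk ?_ _
        refine (PiLp.continuous_toLp 2 _).comp (continuous_pi fun i => ?_)
        fin_cases i
        · exact (continuous_apply u).comp continuous_subtype_val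
        · exact (continuous_apply v).comp continuous_subtype_val
      continuous_invFun := by
        refine Continuous.subtype_mk ?_ _
        refine continuous_pi fun y => ?_
        simp only [inv]
        split_ifs <;> fun_prop }
  exact ⟨e1.trans ((h.image S).trans (Homeomorph.setCongr hh))⟩

end base

def PosT (a b c : ℕ) : Prop := (a = 0 ∧ b = 1 ∧ c = 2) ∨ (b = a + 3 ∧ c = a + 4 ∧ a % 3 ≠ 2)
def NegT (a b c : ℕ) : Prop := b = a + 1 ∧ c = a + 4 ∧ a % 3 = 0

lemma mkT (a b c : ℕ) (h : ((a = 0 ∧ b = 1 ∧ c = 2) ∨ (b = a + 3 ∧ c = a + 4 ∧ a % 3 ≠ 2)) ∨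
    (b = a + 1 ∧ c = a + 4 ∧ a % 3 = 0)) : PosT a b c ∨ NegT a b c := h

/-- triangles with all labels below `m` -/
def TT (N m : ℕ) : Set (Finset (Fin N)) :=
  {s | ∃ a b c : Fin N, (PosT a b c ∨ NegT a b c) ∧ (c : ℕ) < m ∧ s = {a, b, c}}

lemma TT_zero (N : ℕ) (hN : 3 ≤ N) :
    TT N 3 = {{(⟨0, by omega⟩ : Fin N), ⟨1, by omega⟩, ⟨2, by omega⟩}} := by
  ext s
  rw [Set.mem_singleton_iff]
  constructor
  · rintro ⟨⟨a, ha⟩, ⟨b, hb⟩, ⟨c, hc⟩, h, hlt, rfl⟩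
    simp only [PosT, NegT] at h hlt
    ext ⟨y, hy⟩
    simp only [Finset.mem_insert, Finset.mem_singleton, Fin.mk.injEq]
    omega
  · rintro rfl
    exact ⟨_, _, _, Or.inl (Or.inl ⟨rfl, rfl, rfl⟩), by simp, rfl⟩

lemma TT_succ (N k : ℕ) (hN : 3 * k + 6 ≤ N) :
    TT N (3 * k + 6) =
      insert {(⟨3 * k + 1, by omega⟩ : Fin N), ⟨3 * k + 4, by omega⟩, ⟨3 * k + 5, by omega⟩}
      (insert {(⟨3 * k, by omega⟩ : Fin N), ⟨3 * k + 4, by omega⟩, ⟨3 * k + 3, by omega⟩}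
      (insert {(⟨3 * k, by omega⟩ : Fin N), ⟨3 * k + 1, by omega⟩, ⟨3 * k + 4, by omega⟩}
        (TT N (3 * k + 3)))) := by
  ext s
  simp only [Set.mem_insert_iff]
  constructor
  · rintro ⟨⟨a, ha⟩, ⟨b, hb⟩, ⟨c, hc⟩, h, hlt, rfl⟩
    by_cases hc' : c < 3 * k + 3
    · exact Or.inr (Or.inr (Or.inr ⟨_, _, _, h, hc', rfl⟩))
    simp only [PosT, NegT] at h hlt
    have : (a = 3 * k + 1 ∧ b = 3 * k + 4 ∧ c = 3 * k + 5) ∨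
        (a = 3 * k ∧ b = 3 * k + 3 ∧ c = 3 * k + 4) ∨
        (a = 3 * k ∧ b = 3 * k + 1 ∧ c = 3 * k + 4) := by omega
    rcases this with ⟨rfl, rfl, rfl⟩ | ⟨rfl, rfl, rfl⟩ | ⟨rfl, rfl, rfl⟩
    · exact Or.inl rfl
    · right; left
      rw [Finset.pair_comm]
    · right; right; left; rfl
  · rintro (rfl | rfl | rfl | ⟨a, b, c, h, hlt, rfl⟩)
    · refine ⟨⟨3 * k + 1, by omega⟩, ⟨3 * k + 4, by omega⟩, ⟨3 * k + 5, by omega⟩, ?_, ?_, rfl⟩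
      · exact mkT (3 * k + 1) (3 * k + 4) (3 * k + 5) (by omega)
      · simp
    · refine ⟨⟨3 * k, by omega⟩, ⟨3 * k + 3, by omega⟩, ⟨3 * k + 4, by omega⟩, ?_, ?_, by rw [Finset.pair_comm]⟩
      · exact mkT (3 * k) (3 * k + 3) (3 * k + 4) (by omega)
      · simp
    · refine ⟨⟨3 * k, by omega⟩, ⟨3 * k + 1, by omega⟩, ⟨3 * k + 4, by omega⟩, ?_, ?_, rfl⟩
      · exact mkT (3 * k) (3 * k + 1) (3 * k + 4) (by omega)
      · simp
    · exact ⟨a, b, c, h, by omega, rfl⟩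

lemma disc_step {V : Type*} {K L : AbsCx V} (h : Nonempty (K.realization ≃ₜ L.realization))
    (hL : L.IsDiscTriangulation 2) : K.IsDiscTriangulation 2 := by
  obtain ⟨e⟩ := h
  obtain ⟨f⟩ := hL
  exact ⟨e.trans f⟩

lemma TT_disc (N k : ℕ) (hN : 3 * k + 3 ≤ N) :
    (cxOf (TT N (3 * k + 3))).IsDiscTriangulation 2 := by
  induction k with
  | zero =>
    rw [TT_zero N hN]
    apply base_disc <;> simp
  | succ k ih =>
    have ih := ih (by omega)
    rw [show 3 * (k + 1) + 3 = 3 * k + 6 by ring, TT_succ N k (by omega)]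
    refine disc_step (ear_homeo _ _ _ ⟨3 * k, by omega⟩ _ ?_ ?_ ?_ ?_ ?_ ?_) ?_
    · simp
    · simp
    · simp
    · right; left
      ext ⟨y, hy⟩
      simp only [Finset.mem_insert, Finset.mem_singleton, Fin.mk.injEq]
      omega
    · rintro t (rfl | rfl | ⟨⟨a, ha⟩, ⟨b, hb⟩, ⟨c, hc⟩, h, hlt, rfl⟩) <;>
        simp only [Finset.mem_insert, Finset.mem_singleton, Fin.mk.injEq]
      · omega
      · omega
      · simp only [PosT, NegT] at h hlt; omega
    · rintro t (rfl | rfl | ⟨⟨a, ha⟩, ⟨b, hb⟩, ⟨c, hc⟩, h, hlt, rfl⟩) <;>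
        simp only [Finset.mem_insert, Finset.mem_singleton, Fin.mk.injEq] <;> intro h1 h2
      · omega
      · ext ⟨y, hy⟩
        simp only [Finset.mem_insert, Finset.mem_singleton, Fin.mk.injEq]
        omega
      · simp only [PosT, NegT] at h hlt; omega
    refine disc_step (ear_homeo _ _ _ ⟨3 * k + 1, by omega⟩ _ ?_ ?_ ?_ ?_ ?_ ?_) ?_
    · simp
    · simp
    · simp
    · left
      ext ⟨y, hy⟩
      simp only [Finset.mem_insert, Finset.mem_singleton, Fin.mk.injEq]
      omega
    · rintro t (rfl | ⟨⟨a, ha⟩, ⟨b, hb⟩, ⟨c, hc⟩, h, hlt, rfl⟩) <;>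
        simp only [Finset.mem_insert, Finset.mem_singleton, Fin.mk.injEq]
      · omega
      · simp only [PosT, NegT] at h hlt; omega
    · rintro t (rfl | ⟨⟨a, ha⟩, ⟨b, hb⟩, ⟨c, hc⟩, h, hlt, rfl⟩) <;>
        simp only [Finset.mem_insert, Finset.mem_singleton, Fin.mk.injEq] <;> intro h1 h2
      · ext ⟨y, hy⟩
        simp only [Finset.mem_insert, Finset.mem_singleton, Fin.mk.injEq]
        omega
      · simp only [PosT, NegT] at h hlt; omega
    obtain ⟨w, hw, hw'⟩ : ∃ w : ℕ, w < N ∧ ((k = 0 ∧ w = 2) ∨ (k ≠ 0 ∧ w + 3 = 3 * k)) := by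
      rcases Nat.eq_zero_or_pos k with h | h
      · exact ⟨2, by omega, by omega⟩
      · exact ⟨3 * k - 3, by omega, by omega⟩
    refine disc_step (ear_homeo _ _ _ ⟨w, hw⟩ _ ?_ ?_ ?_ ?_ ?_ ?_) ih
    · simp
    · simp only [ne_eq, Fin.mk.injEq]; omega
    · simp only [ne_eq, Fin.mk.injEq]; omega
    · rcases hw' with hw' | hw'
      · refine ⟨⟨3 * k, by omega⟩, ⟨3 * k + 1, by omega⟩, ⟨w, hw⟩, ?_, ?_, rfl⟩
        · exact mkT (3 * k) (3 * k + 1) w (by omega)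
        · simp only; omega
      · refine ⟨⟨w, hw⟩, ⟨3 * k, by omega⟩, ⟨3 * k + 1, by omega⟩, ?_, ?_, ?_⟩
        · exact mkT w (3 * k) (3 * k + 1) (by omega)
        · simp only; omega
        · ext ⟨y, hy⟩
          simp only [Finset.mem_insert, Finset.mem_singleton, Fin.mk.injEq]
          omega
    · rintro t ⟨⟨a, ha⟩, ⟨b, hb⟩, ⟨c, hc⟩, h, hlt, rfl⟩
      simp only [Finset.mem_insert, Finset.mem_singleton, Fin.mk.injEq]
      simp only [PosT, NegT] at h hlt; omega
    · rintro t ⟨⟨a, ha⟩, ⟨b, hb⟩, ⟨c, hc⟩, h, hlt, rfl⟩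
      simp only [Finset.mem_insert, Finset.mem_singleton, Fin.mk.injEq]
      intro h1 h2
      ext ⟨y, hy⟩
      simp only [Finset.mem_insert, Finset.mem_singleton, Fin.mk.injEq]
      simp only [PosT, NegT] at h hlt; omega

/-- cyclically positive triples -/
def CT (a b c : ℕ) : Prop :=
  PosT a b c ∨ PosT b c a ∨ PosT c a b ∨ NegT b a c ∨ NegT a c b ∨ NegT c b a

lemma CT_cyc (a b c : ℕ) : CT b c a ↔ CT a b c := by
  unfold CT; tauto

lemma CT_anti {a b c : ℕ} (h : CT a b c) : ¬ CT b a c := by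
  simp only [CT, PosT, NegT] at *
  omega

lemma CT_ne {a b c : ℕ} (h : CT a b c) : a ≠ b ∧ b ≠ c ∧ a ≠ c := by
  simp only [CT, PosT, NegT] at *
  omega

lemma CT_coh {a a' b c : ℕ} (hne : a ≠ a') (h : CT a b c) : ¬ CT a' b c := by
  simp only [CT, PosT, NegT] at *
  omega

open scoped Classical in
/-- sign of an ordered triple -/
noncomputable def sg3 (a b c : ℕ) : ℤ := if CT a b c then 1 else if CT b a c then -1 else 0

lemma sg3_cyc (a b c : ℕ) : sg3 b c a = sg3 a b c := by
  unfold sg3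
  rw [CT_cyc a b c, ← CT_cyc b a c, ← CT_cyc a c b]

lemma sg3_swap (a b c : ℕ) : sg3 b a c = - sg3 a b c := by
  unfold sg3
  by_cases h : CT a b c
  · simp [h, CT_anti h]
  · by_cases h' : CT b a c <;> simp [h, h']

lemma sg3_coh {a a' b c : ℕ} (hne : a ≠ a') (h : sg3 a b c ≠ 0) (h' : sg3 a' b c ≠ 0) :
    sg3 a' b c = - sg3 a b c := by
  have k1 : CT a b c → ¬ CT a' b c := CT_coh hne
  have k2 : CT b a c → ¬ CT b a' c := by
    rw [← CT_cyc b a c, ← CT_cyc b a' c]; exact CT_coh hne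
  unfold sg3 at *
  by_cases h1 : CT a b c <;> by_cases h2 : CT b a c <;> by_cases h3 : CT a' b c <;>
    by_cases h4 : CT b a' c <;> simp_all

lemma image3 {V : Type*} [DecidableEq V] (x : Fin 3 → V) :
    Finset.image x Finset.univ = {x 0, x 1, x 2} := by
  ext y
  simp [Fin.exists_fin_succ, eq_comm]

lemma perm3 : ∀ σ : Equiv.Perm (Fin 3),
    ((σ 0 = 0 ∧ σ 1 = 1 ∧ σ 2 = 2) ∨ (σ 0 = 1 ∧ σ 1 = 2 ∧ σ 2 = 0) ∨
      (σ 0 = 2 ∧ σ 1 = 0 ∧ σ 2 = 1)) ∧ Equiv.Perm.sign σ = 1 ∨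
    ((σ 0 = 1 ∧ σ 1 = 0 ∧ σ 2 = 2) ∨ (σ 0 = 0 ∧ σ 1 = 2 ∧ σ 2 = 1) ∨
      (σ 0 = 2 ∧ σ 1 = 1 ∧ σ 2 = 0)) ∧ Equiv.Perm.sign σ = -1 := by
  decide

lemma card_TT {N m : ℕ} {t : Finset (Fin N)} (ht : t ∈ TT N m) : t.card = 3 := by
  obtain ⟨a, b, c, h, -, rfl⟩ := ht
  simp only [PosT, NegT] at h
  refine Finset.card_eq_three.2 ⟨a, b, c, ?_, ?_, ?_, rfl⟩ <;>
    rw [ne_eq, Fin.ext_iff] <;> omega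

lemma face3 {N m : ℕ} (s : Finset (Fin N)) :
    s ∈ (cxOf (TT N m)).faces ∧ s.card = 3 ↔ s ∈ TT N m := by
  constructor
  · rintro ⟨⟨-, t, ht, hst⟩, hc⟩
    rwa [Finset.eq_of_subset_of_card_le hst (by rw [card_TT ht, hc])]
  · intro h
    refine ⟨⟨?_, s, h, subset_rfl⟩, card_TT h⟩
    rw [← Finset.card_pos, card_TT h]; norm_num

lemma CT_TT {N : ℕ} {a b c : Fin N} (h : CT a b c) : {a, b, c} ∈ TT N N := by
  rcases h with h | h | h | h | h | h
  · exact ⟨_, _, _, Or.inl h, Fin.isLt _, rfl⟩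
  · exact ⟨_, _, _, Or.inl h, Fin.isLt _, by ext; simp; tauto⟩
  · exact ⟨_, _, _, Or.inl h, Fin.isLt _, by ext; simp; tauto⟩
  · exact ⟨_, _, _, Or.inr h, Fin.isLt _, by ext; simp; tauto⟩
  · exact ⟨_, _, _, Or.inr h, Fin.isLt _, by ext; simp; tauto⟩
  · exact ⟨_, _, _, Or.inr h, Fin.isLt _, by ext; simp; tauto⟩

lemma TT_CT {N : ℕ} {a b c : Fin N} (hab : a ≠ b) (hac : a ≠ c) (hbc : b ≠ c)
    (h : {a, b, c} ∈ TT N N) : CT a b c ∨ CT b a c := by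
  obtain ⟨p, q, r, h, -, he⟩ := h
  have ha : a ∈ ({p, q, r} : Finset (Fin N)) := by rw [← he]; simp
  have hb : b ∈ ({p, q, r} : Finset (Fin N)) := by rw [← he]; simp
  have hc : c ∈ ({p, q, r} : Finset (Fin N)) := by rw [← he]; simp
  simp only [Finset.mem_insert, Finset.mem_singleton] at ha hb hc
  unfold CT
  rcases ha with rfl | rfl | rfl <;> rcases hb with rfl | rfl | rfl <;>
    rcases hc with rfl | rfl | rfl <;> first | contradiction | tauto

/-- the orientation -/
noncomputable def ori (N : ℕ) : CoherentOrientation 2 (cxOf (TT N N)) where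
  sign x := sg3 (x 0) (x 1) (x 2)
  sign_perm x σ := by
    have h := perm3 σ
    have s1 := sg3_cyc (x 0) (x 1) (x 2)
    have s2 := sg3_cyc (x 1) (x 2) (x 0)
    have s3 := sg3_swap (x 0) (x 1) (x 2)
    have s4 := sg3_cyc (x 1) (x 0) (x 2)
    have s5 := sg3_cyc (x 0) (x 2) (x 1)
    simp only [Function.comp_apply]
    rcases h with ⟨⟨h0, h1, h2⟩ | ⟨h0, h1, h2⟩ | ⟨h0, h1, h2⟩, hs⟩ |
      ⟨⟨h0, h1, h2⟩ | ⟨h0, h1, h2⟩ | ⟨h0, h1, h2⟩, hs⟩ <;>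
      rw [h0, h1, h2, hs] <;> push_cast <;> linarith
  sign_unit x hx hf := by
    have h3 := (face3 _).1 ⟨hf, by rw [Finset.card_image_of_injective _ hx]; simp⟩
    rw [image3] at h3
    have := TT_CT (hx.ne (by decide)) (hx.ne (by decide)) (hx.ne (by decide)) h3
    unfold sg3
    rcases this with h | h
    · simp [h]
    · simp [h, CT_anti h]
  sign_zero x hx := by
    have key : ¬ (CT (x 0) (x 1) (x 2) ∨ CT (x 1) (x 0) (x 2)) := by
      intro h
      have hne : x 0 ≠ x 1 ∧ x 1 ≠ x 2 ∧ x 0 ≠ x 2 := by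
        simp only [ne_eq, Fin.ext_iff]
        rcases h with h | h <;> have := CT_ne h <;> omega
      have hm : {x 0, x 1, x 2} ∈ TT N N := by
        rcases h with h | h
        · exact CT_TT h
        · rw [Finset.insert_comm]; exact CT_TT h
      rcases hx with hx | hx
      · apply hx
        intro i j hij
        obtain ⟨n1, n2, n3⟩ := hne
        fin_cases i <;> fin_cases j <;> simp_all
      · rw [image3] at hx
        exact hx ((face3 _).2 hm).1
    push Not at key
    simp [sg3, key.1, key.2]
  coherent x y := by
    rintro ⟨i, hi, hj⟩ h1 h2
    have hv : (x i : ℕ) ≠ y i := fun h => hi (Fin.ext h)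
    fin_cases i
    · have e1 := hj 1 (by decide)
      have e2 := hj 2 (by decide)
      rw [← e1, ← e2] at h2 ⊢
      exact sg3_coh hv h1 h2
    · have e1 := hj 0 (by decide)
      have e2 := hj 2 (by decide)
      rw [← e1, ← e2] at h2 ⊢
      rw [← sg3_cyc] at h1 h2 ⊢
      rw [← sg3_cyc (x 0) (x 1)]
      exact sg3_coh hv h1 h2
    · have e1 := hj 0 (by decide)
      have e2 := hj 1 (by decide)
      rw [← e1, ← e2] at h2 ⊢
      rw [sg3_cyc (y 2) (x 0) (x 1)] at h2 ⊢
      rw [sg3_cyc (x 2) (x 0) (x 1)] at h1 ⊢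
      exact sg3_coh hv h1 h2

lemma pos_eq (N : ℕ) : posTriangles (ori N) =
    {s | ∃ a b c : Fin N, PosT a b c ∧ s = {a, b, c}} := by
  ext s
  constructor
  · rintro ⟨x, hx, rfl, hs⟩
    refine ⟨x 0, x 1, x 2, ?_, image3 x⟩
    have h1 : x 0 < x 1 := hx (by decide)
    have h2 : x 1 < x 2 := hx (by decide)
    rw [Fin.lt_def] at h1 h2
    have hc : CT (x 0) (x 1) (x 2) := by
      by_contra h
      change sg3 _ _ _ = _ at hs
      unfold sg3 at hs
      rw [if_neg h] at hs
      split_ifs at hs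
      simp at hs
    simp only [CT, PosT, NegT] at *
    omega
  · rintro ⟨a, b, c, h, rfl⟩
    have hab : a < b := by rw [Fin.lt_def]; unfold PosT at h; omega
    have hbc : b < c := by rw [Fin.lt_def]; unfold PosT at h; omega
    refine ⟨![a, b, c], ?_, by rw [image3]; rfl, ?_⟩
    · intro i j hij
      fin_cases i <;> fin_cases j <;> simp_all
      exact hab.trans hbc
    · change sg3 a b c = 1
      simp [sg3, CT, h]

lemma neg_eq (N : ℕ) : negTriangles (ori N) =
    {s | ∃ a b c : Fin N, NegT a b c ∧ s = {a, b, c}} := by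
  ext s
  constructor
  · rintro ⟨x, hx, rfl, hs⟩
    refine ⟨x 0, x 1, x 2, ?_, image3 x⟩
    have h1 : x 0 < x 1 := hx (by decide)
    have h2 : x 1 < x 2 := hx (by decide)
    rw [Fin.lt_def] at h1 h2
    have hc : CT (x 1) (x 0) (x 2) := by
      by_contra h
      change sg3 _ _ _ = _ at hs
      unfold sg3 at hs
      rw [if_neg h] at hs
      split_ifs at hs
    simp only [CT, PosT, NegT] at *
    omega
  · rintro ⟨a, b, c, h, rfl⟩
    have hab : a < b := by rw [Fin.lt_def]; unfold NegT at h; omega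
    have hbc : b < c := by rw [Fin.lt_def]; unfold NegT at h; omega
    refine ⟨![a, b, c], ?_, by rw [image3]; rfl, ?_⟩
    · intro i j hij
      fin_cases i <;> fin_cases j <;> simp_all
      exact hab.trans hbc
    · change sg3 a b c = -1
      have hc : CT b a c := by simp [CT, h]
      simp [sg3, hc, CT_anti hc]

lemma trip_inj {N : ℕ} {a b c a' b' c' : Fin N} (hab : a < b) (hbc : b < c) (hab' : a' < b')
    (hbc' : b' < c') (h : ({a, b, c} : Finset (Fin N)) = {a', b', c'}) :
    (a : ℕ) = a' ∧ (b : ℕ) = b' ∧ (c : ℕ) = c' := by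
  have h1 : a ∈ ({a', b', c'} : Finset (Fin N)) := by rw [← h]; simp
  have h2 : b ∈ ({a', b', c'} : Finset (Fin N)) := by rw [← h]; simp
  have h3 : c ∈ ({a', b', c'} : Finset (Fin N)) := by rw [← h]; simp
  simp only [Finset.mem_insert, Finset.mem_singleton, Fin.ext_iff, Fin.lt_def] at *
  omega

lemma neg_card (d : ℕ) (hd : 1 ≤ d) :
    Set.ncard {s : Finset (Fin (3 * d)) | ∃ a b c : Fin (3 * d), NegT a b c ∧ s = {a, b, c}} = d - 1 := by
  refine Set.ncard_eq_of_bijective (fun i hi =>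
    {⟨3 * i, by omega⟩, ⟨3 * i + 1, by omega⟩, ⟨3 * i + 4, by omega⟩}) ?_ ?_ ?_
  · rintro s ⟨⟨a, ha⟩, ⟨b, hb⟩, ⟨c, hc⟩, h, rfl⟩
    simp only [NegT] at h
    refine ⟨a / 3, by omega, ?_⟩
    ext ⟨y, hy⟩
    simp only [Finset.mem_insert, Finset.mem_singleton, Fin.mk.injEq]
    omega
  · intro i hi
    refine ⟨⟨3 * i, by omega⟩, ⟨3 * i + 1, by omega⟩, ⟨3 * i + 4, by omega⟩, ?_, rfl⟩
    have h : 3 * i % 3 = 0 := by omega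
    exact ⟨rfl, rfl, h⟩
  · intro i j hi hj h
    have := trip_inj (by simp) (by simp) (by simp) (by simp) h
    simp only at this
    omega

lemma posIdx (i : ℕ) : ∃ a b c : ℕ, PosT a b c ∧ (i = 0 → c = 2) ∧
    (i ≠ 0 → c = (i - 1) / 2 * 3 + (i - 1) % 2 + 4) := by
  rcases Nat.eq_zero_or_pos i with h | h
  · exact ⟨0, 1, 2, by (unfold PosT; omega), by omega, by omega⟩
  · refine ⟨(i - 1) / 2 * 3 + (i - 1) % 2, (i - 1) / 2 * 3 + (i - 1) % 2 + 3,
      (i - 1) / 2 * 3 + (i - 1) % 2 + 4, by (unfold PosT; omega), by omega, by omega⟩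

lemma pos_card (d : ℕ) (hd : 1 ≤ d) :
    Set.ncard {s : Finset (Fin (3 * d)) | ∃ a b c : Fin (3 * d), PosT a b c ∧ s = {a, b, c}} = 2 * d - 1 := by
  choose A B C hP h0 h1 using posIdx
  have hlt : ∀ i, A i < B i ∧ B i < C i := fun i => by
    have := hP i; simp only [PosT] at this; omega
  have hC : ∀ i, i < 2 * d - 1 → C i < 3 * d := fun i hi => by
    have := h0 i
    have := h1 i
    omega
  refine Set.ncard_eq_of_bijective (fun i hi =>
    {⟨A i, ((hlt i).1.trans (hlt i).2).trans (hC i hi)⟩, ⟨B i, (hlt i).2.trans (hC i hi)⟩,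
      ⟨C i, hC i hi⟩}) ?_ ?_ ?_
  · rintro s ⟨⟨a, ha⟩, ⟨b, hb⟩, ⟨c, hc⟩, h, rfl⟩
    simp only [PosT] at h
    obtain ⟨i, hi, hci⟩ : ∃ i, i < 2 * d - 1 ∧ C i = c := by
      rcases h with h | h
      · exact ⟨0, by omega, by rw [h0 0 rfl]; omega⟩
      · refine ⟨a / 3 * 2 + a % 3 + 1, by omega, ?_⟩
        rw [h1 _ (by omega)]; omega
    have hp := hP i
    simp only [PosT] at hp
    have e1 : A i = a := by omega
    have e2 : B i = b := by omega
    refine ⟨i, hi, ?_⟩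
    simp only [e1, e2, hci]
  · intro i hi
    exact ⟨_, _, _, hP i, rfl⟩
  · intro i j hi hj h
    have := trip_inj (by simpa using (hlt i).1) (by simpa using (hlt i).2)
      (by simpa using (hlt j).1) (by simpa using (hlt j).2) h
    simp only at this
    have := h0 i
    have := h1 i
    have := h0 j
    have := h1 j
    omega

lemma TT_card (d : ℕ) (hd : 1 ≤ d) : Set.ncard (TT (3 * d) (3 * d)) = 3 * d - 2 := by
  have : TT (3 * d) (3 * d) = {s | ∃ a b c : Fin (3 * d), PosT a b c ∧ s = {a, b, c}} ∪
      {s | ∃ a b c : Fin (3 * d), NegT a b c ∧ s = {a, b, c}} := by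
    ext s
    constructor
    · rintro ⟨a, b, c, h | h, -, rfl⟩
      · exact Or.inl ⟨a, b, c, h, rfl⟩
      · exact Or.inr ⟨a, b, c, h, rfl⟩
    · rintro (⟨a, b, c, h, rfl⟩ | ⟨a, b, c, h, rfl⟩)
      · exact ⟨a, b, c, Or.inl h, c.isLt, rfl⟩
      · exact ⟨a, b, c, Or.inr h, c.isLt, rfl⟩
  rw [this, Set.ncard_union_eq, pos_card d hd, neg_card d hd]
  · omega
  · rw [Set.disjoint_left]
    rintro s ⟨a, b, c, h, rfl⟩ ⟨a', b', c', h', he⟩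
    simp only [PosT, NegT] at h h'
    have := trip_inj (by rw [Fin.lt_def]; omega) (by rw [Fin.lt_def]; omega)
      (by rw [Fin.lt_def]; omega) (by rw [Fin.lt_def]; omega) he
    omega

lemma bdry_mk {N : ℕ} (p q r : Fin N) (hpq : p ≠ q) (hT : {p, q, r} ∈ TT N N)
    (hu : ∀ t ∈ TT N N, p ∈ t → q ∈ t → t = {p, q, r}) :
    {p, q} ∈ (cxOf (TT N N)).boundaryEdges := by
  have hsub : ({p, q} : Finset (Fin N)) ⊆ {p, q, r} := by
    intro y; simp; tauto
  refine ⟨⟨⟨p, by simp⟩, _, hT, hsub⟩, Finset.card_pair hpq, ?_⟩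
  rw [Set.ncard_eq_one]
  refine ⟨{p, q, r}, ?_⟩
  ext t
  rw [Set.mem_singleton_iff, Set.mem_ofPred_eq, ← and_assoc, face3]
  constructor
  · rintro ⟨ht, hs⟩
    exact hu t ht (hs (by simp)) (hs (by simp))
  · rintro rfl
    exact ⟨hT, hsub⟩

lemma bdry_unique {N : ℕ} {e s t : Finset (Fin N)} (he : e ∈ (cxOf (TT N N)).boundaryEdges)
    (hs : s ∈ TT N N) (ht : t ∈ TT N N) (hes : e ⊆ s) (het : e ⊆ t) : s = t := by
  obtain ⟨-, -, h⟩ := he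
  rw [Set.ncard_eq_one] at h
  obtain ⟨r, hr⟩ := h
  have h1 : s ∈ ({r} : Set (Finset (Fin N))) := by
    rw [← hr, Set.mem_ofPred_eq, ← and_assoc, face3]; exact ⟨hs, hes⟩
  have h2 : t ∈ ({r} : Set (Finset (Fin N))) := by
    rw [← hr, Set.mem_ofPred_eq, ← and_assoc, face3]; exact ⟨ht, het⟩
  rw [Set.mem_singleton_iff] at h1 h2
  rw [h1, h2]

lemma bdry_mk' {N : ℕ} (a b c p q r : ℕ) (ha : a < N) (hb : b < N) (hc : c < N)
    (hp : p < N) (hq : q < N) (hr : r < N) (h : PosT a b c)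
    (hperm : ∀ y, (y = a ∨ y = b ∨ y = c) ↔ (y = p ∨ y = q ∨ y = r)) (hpq : p ≠ q)
    (hu : ∀ a' b' c', PosT a' b' c' ∨ NegT a' b' c' → (p = a' ∨ p = b' ∨ p = c') →
      (q = a' ∨ q = b' ∨ q = c') → a' = a ∧ b' = b ∧ c' = c) :
    {⟨p, hp⟩, ⟨q, hq⟩} ∈ (cxOf (TT N N)).boundaryEdges := by
  have key : ({⟨a, ha⟩, ⟨b, hb⟩, ⟨c, hc⟩} : Finset (Fin N)) = {⟨p, hp⟩, ⟨q, hq⟩, ⟨r, hr⟩} := by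
    ext ⟨y, hy⟩
    simp only [Finset.mem_insert, Finset.mem_singleton, Fin.mk.injEq]
    exact hperm y
  refine bdry_mk _ _ ⟨r, hr⟩ (by simpa using hpq) ?_ ?_
  · rw [← key]
    exact ⟨_, _, _, Or.inl h, hc, rfl⟩
  · rintro t ⟨⟨a', ha'⟩, ⟨b', hb'⟩, ⟨c', hc'⟩, h', -, rfl⟩
    simp only [Finset.mem_insert, Finset.mem_singleton, Fin.mk.injEq]
    intro k1 k2
    obtain ⟨rfl, rfl, rfl⟩ := hu a' b' c' h' k1 k2
    exact key

lemma bdry_vertex (d : ℕ) (v : Fin (3 * d)) :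
    ∃ e ∈ (cxOf (TT (3 * d) (3 * d))).boundaryEdges, v ∈ e := by
  obtain ⟨v, hv⟩ := v
  by_cases h0 : v = 0
  · refine ⟨_, bdry_mk' 0 1 2 0 2 1 (by omega) (by omega) (by omega) (by omega) (by omega)
      (by omega) (by simp [PosT]) (by omega) (by omega) ?_, by simp [h0]⟩
    (unfold PosT NegT; omega)
  by_cases h1 : v % 3 = 0
  · obtain ⟨k, rfl⟩ : ∃ k, v = k + 3 := ⟨v - 3, by omega⟩
    refine ⟨_, bdry_mk' k (k + 3) (k + 4) k (k + 3) (k + 4) (by omega) (by omega) (by omega)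
      (by omega) (by omega)
      (by omega) (by (unfold PosT; omega)) (by omega) (by omega) ?_, by simp⟩
    (unfold PosT NegT; omega)
  by_cases h2 : v < 3
  · refine ⟨_, bdry_mk' 0 1 2 1 2 0 (by omega) (by omega) (by omega) (by omega) (by omega)
      (by omega) (by simp [PosT]) (by omega) (by omega) ?_, ?_⟩
    · (unfold PosT NegT; omega)
    · simp only [Finset.mem_insert, Finset.mem_singleton, Fin.mk.injEq]; omega
  · obtain ⟨k, hk, hk1⟩ : ∃ k, k % 3 = 1 ∧ (v = k + 3 ∨ v = k + 4) := by
      by_cases h : v % 3 = 1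
      · exact ⟨v - 3, by omega, by omega⟩
      · exact ⟨v - 4, by omega, by omega⟩
    refine ⟨_, bdry_mk' k (k + 3) (k + 4) (k + 3) (k + 4) k (by omega) (by omega) (by omega)
      (by omega) (by omega)
      (by omega) (by (unfold PosT; omega)) (by omega) (by omega) ?_, ?_⟩
    · (unfold PosT NegT; omega)
    · simp only [Finset.mem_insert, Finset.mem_singleton, Fin.mk.injEq]; omega

lemma bdry_pos (d : ℕ) {e s : Finset (Fin (3 * d))}
    (he : e ∈ (cxOf (TT (3 * d) (3 * d))).boundaryEdges)
    (hs : s ∈ TT (3 * d) (3 * d)) (hes : e ⊆ s) :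
    ∃ a b c : Fin (3 * d), PosT a b c ∧ s = {a, b, c} := by
  have hs' := hs
  obtain ⟨a, b, c, h | h, -, rfl⟩ := hs
  · exact ⟨a, b, c, h, rfl⟩
  exfalso
  have hcard : e.card = 2 := he.2.1
  have hmem : ∀ y ∈ e, (y : ℕ) = a ∨ (y : ℕ) = b ∨ (y : ℕ) = c := by
    intro y hy
    have := hes hy
    simpa [Fin.ext_iff] using this
  -- any other positive triangle containing the edge is a contradiction
  have key : ∀ p q r : ℕ, PosT p q r → r < 3 * d →
      (∀ y ∈ e, (y : ℕ) = p ∨ (y : ℕ) = q ∨ (y : ℕ) = r) → False := by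
    intro p q r hp hr hy
    have hpr : p < q ∧ q < r := by simp only [PosT] at hp; omega
    have ht : ({⟨p, by omega⟩, ⟨q, by omega⟩, ⟨r, hr⟩} : Finset (Fin (3 * d))) ∈
        TT (3 * d) (3 * d) := ⟨_, _, _, Or.inl hp, hr, rfl⟩
    have heq := bdry_unique he hs' ht hes (by
      intro y hye
      simpa [Fin.ext_iff] using hy y hye)
    simp only [PosT, NegT] at hp h
    have := trip_inj (by rw [Fin.lt_def]; omega) (by rw [Fin.lt_def]; omega)
      (by rw [Fin.lt_def]; simp only; omega) (by rw [Fin.lt_def]; simp only; omega) heq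
    simp only at this
    omega
  have hcl := c.isLt
  simp only [NegT] at h
  have hnot : ∀ z : Fin (3 * d), z ∉ e → ∀ y ∈ e, (y : ℕ) ≠ z := by
    intro z hz y hy hyz
    exact hz (by rwa [← Fin.ext hyz])
  by_cases ha : a ∈ e
  · by_cases hb : b ∈ e
    · by_cases hc : c ∈ e
      · have : ({a, b, c} : Finset (Fin (3 * d))) ⊆ e := by
          intro y hy
          simp only [Finset.mem_insert, Finset.mem_singleton] at hy
          rcases hy with rfl | rfl | rfl <;> assumption
        have := Finset.card_le_card this
        rw [card_TT hs'] at this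
        omega
      · by_cases ha0 : (a : ℕ) = 0
        · refine key 0 1 2 (by simp [PosT]) (by omega) fun y hy => ?_
          have := hmem y hy
          have := hnot c hc y hy
          omega
        · refine key (a - 3) a (a + 1) (by (unfold PosT; omega)) (by omega) fun y hy => ?_
          have := hmem y hy
          have := hnot c hc y hy
          omega
    · refine key a (a + 3) (a + 4) (by (unfold PosT; omega)) (by omega) fun y hy => ?_
      have := hmem y hy
      have := hnot b hb y hy
      omega
  · refine key (a + 1) (a + 4) (a + 5) (by (unfold PosT; omega)) (by omega) fun y hy => ?_
    have := hmem y hy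
    have := hnot a ha y hy
    omega

/-- For every `d ≥ 1` there is a triangulated disc `Δ_d` with `3d` boundary vertices and
`3d - 2` triangles, carrying a coherent orientation with exactly `2d - 1` positive and
`d - 1` negative triangles, all boundary edges lying in positive triangles. -/
theorem stmt3 (d : ℕ) (hd : 1 ≤ d) :
    ∃ K : AbsCx (Fin (3 * d)),
      (∀ s ∈ K.faces, s.card ≤ 3) ∧
      K.IsDiscTriangulation 2 ∧
      K.vertexSet = Set.univ ∧
      (∀ v : Fin (3 * d), ∃ e ∈ K.boundaryEdges, v ∈ e) ∧
      Set.ncard {s | s ∈ K.faces ∧ s.card = 3} = 3 * d - 2 ∧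
      ∃ o : CoherentOrientation 2 K,
        Set.ncard (posTriangles o) = 2 * d - 1 ∧
        Set.ncard (negTriangles o) = d - 1 ∧
        ∀ e ∈ K.boundaryEdges, ∀ s ∈ K.faces, s.card = 3 → e ⊆ s →
          s ∈ posTriangles o := by

  refine ⟨cxOf (TT (3 * d) (3 * d)), ?_, ?_, ?_, bdry_vertex d, ?_, ori (3 * d), ?_, ?_, ?_⟩
  · rintro s ⟨-, t, ht, hst⟩
    exact (Finset.card_le_card hst).trans (card_TT ht).le
  · obtain ⟨k, rfl⟩ : ∃ k, d = k + 1 := ⟨d - 1, by omega⟩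
    exact TT_disc _ k le_rfl
  · refine Set.eq_univ_of_forall fun v => ?_
    obtain ⟨e, he, hv⟩ := bdry_vertex d v
    exact (cxOf _).down_closed he.1 (Finset.singleton_subset_iff.2 hv) (by simp)
  · simp only [face3]
    exact TT_card d hd
  · rw [pos_eq]
    exact pos_card d hd
  · rw [neg_eq]
    exact neg_card d hd
  · intro e he s hs hc hes
    rw [pos_eq]
    exact bdry_pos d he ((face3 s).1 ⟨hs, hc⟩) hes
end

section
/- For every nonzero integer d and every n ≥ 2, there exists a triangulated n-sphere K with 3|d| + n - 1 vertices and a simplicial map f : K → S^n_{n+2} to the boundary of the (n+1)-simplex, such that the degree of f (the integer by which f acts on the n-th homology) equals d. -/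
open Finset

open AbsCx


/-! ## The complex -/

/-- The boundary of the join of an `(n-1)`-simplex and a path with `J+1` vertices. -/
def Kc (n J : ℕ) : AbsCx (Fin (n + (J + 1))) where
  faces := {s | s.Nonempty ∧ ∃ j < J,
    (∀ a ∈ s, a.val < n ∨ a.val = n + j ∨ a.val = n + j + 1) ∧
    ((∃ i : Fin n, Fin.castAdd (J + 1) i ∉ s) ∨ (∀ a ∈ s, a.val ≤ n) ∨
      (∀ a ∈ s, a.val < n ∨ a.val = n + J))}
  down_closed := by
    rintro _ _ ⟨_, j, hj, h1, h2⟩ hts ht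
    refine ⟨ht, j, hj, fun a ha => h1 a (hts ha), ?_⟩
    rcases h2 with ⟨i, hi⟩ | h | h
    · exact Or.inl ⟨i, fun h => hi (hts h)⟩
    · exact Or.inr (Or.inl fun a ha => h a (hts ha))
    · exact Or.inr (Or.inr fun a ha => h a (hts ha))
  nonempty_of_mem := fun _ hs => hs.1

theorem Kc_vertexSet (n J : ℕ) (hn : 2 ≤ n) (hJ : 1 ≤ J) : (Kc n J).vertexSet = Set.univ := by
  ext v
  simp only [vertexSet, Kc, Set.mem_ofPred_eq, Set.mem_univ, iff_true, Finset.mem_singleton,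
    forall_eq, Finset.singleton_nonempty, true_and]
  have hv := v.isLt
  have h2 : ∃ i : Fin n, ¬ Fin.castAdd (J + 1) i = v := by
    by_cases h : v.val = 0
    · refine ⟨⟨1, by omega⟩, fun h' => ?_⟩
      have := congrArg Fin.val h'
      simp at this; omega
    · refine ⟨⟨0, by omega⟩, fun h' => ?_⟩
      have := congrArg Fin.val h'
      simp at this; omega
  by_cases h : v.val = n + J
  · exact ⟨J - 1, by omega, by omega, Or.inl h2⟩
  · exact ⟨v.val - n, by omega, by omega, Or.inl h2⟩

/-! ## Topology -/

/-- The corner simplex. -/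
def corner (n : ℕ) : Set (EuclideanSpace ℝ (Fin (n + 1))) :=
  {x | (∀ i, 0 ≤ x i) ∧ ∑ i, x i ≤ 1}

theorem corner_convex (n : ℕ) : Convex ℝ (corner n) := by
  rintro x ⟨hx, hx'⟩ y ⟨hy, hy'⟩ a b ha hb hab
  refine ⟨fun i => ?_, ?_⟩
  · have := hx i; have := hy i
    simp only [PiLp.add_apply, PiLp.smul_apply, smul_eq_mul]; positivity
  · simp only [PiLp.add_apply, PiLp.smul_apply, smul_eq_mul, Finset.sum_add_distrib,
      ← Finset.mul_sum]
    nlinarith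

theorem corner_closed (n : ℕ) : IsClosed (corner n) := by
  have : corner n = (⋂ i, {x | 0 ≤ x i}) ∩ {x | ∑ i, x i ≤ 1} := by
    ext x; simp [corner]
  rw [this]
  refine (isClosed_iInter fun i => isClosed_le (by fun_prop) (by fun_prop)).inter
    (isClosed_le (by fun_prop) (by fun_prop))

theorem corner_interior (n : ℕ) :
    interior (corner n) = {x | (∀ i, 0 < x i) ∧ ∑ i, x i < 1} := by
  apply Set.Subset.antisymm
  · intro x hx
    have key : ∀ v : EuclideanSpace ℝ (Fin (n+1)), ∃ t : ℝ, t > 0 ∧ x + t • v ∈ corner n := by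
      intro v
      have hc : Filter.Tendsto (fun t : ℝ => x + t • v) (nhdsWithin 0 (Set.Ioi 0)) (nhds x) := by
        have : Continuous (fun t : ℝ => x + t • v) := by fun_prop
        have h := this.tendsto 0
        simp only [zero_smul, add_zero] at h
        exact h.mono_left nhdsWithin_le_nhds
      have h1 := hc.eventually (mem_interior_iff_mem_nhds.mp hx)
      obtain ⟨t, ht, ht'⟩ := (h1.and self_mem_nhdsWithin).exists
      exact ⟨t, ht', ht⟩
    refine ⟨fun i => ?_, ?_⟩
    · obtain ⟨t, ht, h, -⟩ := key (-(EuclideanSpace.single i 1))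
      have := h i
      simp at this
      linarith
    · obtain ⟨t, ht, -, h⟩ := key (EuclideanSpace.single 0 1)
      simp [Finset.sum_add_distrib] at h
      linarith
  · apply interior_maximal
    · rintro x ⟨h, h'⟩
      exact ⟨fun i => (h i).le, h'.le⟩
    · have : {x : EuclideanSpace ℝ (Fin (n+1)) | (∀ i, 0 < x i) ∧ ∑ i, x i < 1}
          = (⋂ i, {x | 0 < x i}) ∩ {x | ∑ i, x i < 1} := by
        ext x; simp
      rw [this]
      exact (isOpen_iInter_of_finite fun i => isOpen_lt (by fun_prop) (by fun_prop)).inter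
        (isOpen_lt (by fun_prop) (by fun_prop))

theorem corner_bounded (n : ℕ) : Bornology.IsBounded (corner n) := by
  refine (Metric.isBounded_closedBall (x := (0 : EuclideanSpace ℝ (Fin (n+1)))) (r := 1)).subset ?_
  rintro x ⟨h, h'⟩
  simp only [Metric.mem_closedBall, dist_zero_right]
  rw [EuclideanSpace.norm_eq, Real.sqrt_le_one]
  refine le_trans (Finset.sum_le_sum fun i _ => ?_) h'
  have h1 : x i ≤ 1 := le_trans (Finset.single_le_sum (fun j _ => h j) (Finset.mem_univ i)) h'
  have := h i
  rw [Real.norm_eq_abs, sq_abs]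
  nlinarith

theorem corner_frontier (n : ℕ) : frontier (corner n) =
    {x | (∀ i, 0 ≤ x i) ∧ ∑ i, x i ≤ 1 ∧ ((∃ i, x i = 0) ∨ ∑ i, x i = 1)} := by
  rw [(corner_closed n).frontier_eq, corner_interior]
  ext x
  simp only [corner, Set.mem_sdiff, Set.mem_ofPred_eq, not_and, not_lt]
  constructor
  · rintro ⟨⟨h1, h2⟩, h3⟩
    refine ⟨h1, h2, ?_⟩
    by_contra hc
    push Not at hc
    exact hc.2 (le_antisymm h2 (h3 fun i => lt_of_le_of_ne (h1 i) (hc.1 i).symm))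
  · rintro ⟨h1, h2, h3⟩
    refine ⟨⟨h1, h2⟩, fun h => ?_⟩
    rcases h3 with ⟨i, hi⟩ | h3
    · exact absurd (h i) (by simp [hi])
    · exact h3.ge

theorem corner_sphere (n : ℕ) :
    Nonempty (frontier (corner n) ≃ₜ Metric.sphere (0 : EuclideanSpace ℝ (Fin (n+1))) 1) := by
  have hne : (interior (corner n)).Nonempty := by
    rw [corner_interior]
    refine ⟨WithLp.toLp 2 (fun _ => 1 / (n + 2 : ℝ)), fun i => ?_, ?_⟩
    · simp only; positivity
    · simp only [Finset.sum_const, Finset.card_univ, Fintype.card_fin, nsmul_eq_mul]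
      rw [mul_one_div, div_lt_one (by positivity)]
      push_cast; linarith
  obtain ⟨h, -, -, h3⟩ := exists_homeomorph_image_interior_closure_frontier_eq_unitBall
    (corner_convex n) hne (corner_bounded n)
  exact ⟨(h.image _).trans (Homeomorph.setCongr h3)⟩

theorem exists_seg (J : ℕ) (hJ : 1 ≤ J) (X r : ℝ) (h0 : 0 ≤ X) (h1 : X ≤ J * r) :
    ∃ j < J, j * r ≤ X ∧ X ≤ (j + 1) * r := by
  induction J, hJ using Nat.le_induction with
  | base => exact ⟨0, by omega, by simpa using h0, by simpa using h1⟩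
  | succ J hJ ih =>
    by_cases h : X ≤ J * r
    · obtain ⟨j, hj, h⟩ := ih h
      exact ⟨j, by omega, h⟩
    · exact ⟨J, by omega, (not_le.mp h).le, by simpa using h1⟩

/-- Explicit description of the realization. -/
theorem mem_real_iff (n J : ℕ) (g : Fin (n + (J + 1)) → ℝ) :
    g ∈ (Kc n J).realization ↔ (∀ v, 0 ≤ g v) ∧ ∑ v, g v = 1 ∧ ∃ j < J,
      (∀ k : Fin (J + 1), k.val ≠ j → k.val ≠ j + 1 → g (Fin.natAdd n k) = 0) ∧
      ((∃ i : Fin n, g (Fin.castAdd (J + 1) i) = 0) ∨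
        (∀ k : Fin (J + 1), k.val ≠ 0 → g (Fin.natAdd n k) = 0) ∨
        (∀ k : Fin (J + 1), k.val ≠ J → g (Fin.natAdd n k) = 0)) := by
  constructor
  · rintro ⟨h0, s, ⟨hs, j, hj, hs1, hs2⟩, hsupp, hsum⟩
    refine ⟨h0, ?_, j, hj, ?_, ?_⟩
    · rw [← hsum]
      exact (Finset.sum_subset (Finset.subset_univ s) (fun v _ hv => hsupp v hv)).symm
    · intro k hk hk'
      refine hsupp _ fun hmem => ?_
      have := hs1 _ hmem
      simp at this
      omega
    · rcases hs2 with ⟨i, hi⟩ | h | h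
      · exact Or.inl ⟨i, hsupp _ hi⟩
      · refine Or.inr (Or.inl fun k hk => hsupp _ fun hmem => ?_)
        have := h _ hmem
        rw [Fin.val_natAdd] at this
        omega
      · refine Or.inr (Or.inr fun k hk => hsupp _ fun hmem => ?_)
        have := h _ hmem
        simp at this
        omega
  · rintro ⟨h0, hsum, j, hj, h1, h2⟩
    have hu : ∀ a : Fin (n + (J + 1)), n ≤ a.val →
        ∃ k : Fin (J + 1), a = Fin.natAdd n k ∧ k.val = a.val - n := by
      intro a ha
      exact ⟨⟨a.val - n, by omega⟩, by ext; simp; omega, rfl⟩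
    refine ⟨h0, Finset.univ.filter (fun v => g v ≠ 0), ⟨?_, j, hj, ?_, ?_⟩, ?_, ?_⟩
    · by_contra hc
      rw [Finset.not_nonempty_iff_eq_empty, Finset.filter_eq_empty_iff] at hc
      have : ∑ v, g v = 0 := Finset.sum_eq_zero fun v hv => by simpa using hc hv
      linarith
    · intro a ha
      simp only [Finset.mem_filter, Finset.mem_univ, true_and] at ha
      by_contra hc
      push Not at hc
      obtain ⟨k, hk, hk'⟩ := hu a hc.1
      apply ha
      rw [hk]
      exact h1 k (by omega) (by omega)
    · simp only [Finset.mem_filter, Finset.mem_univ, true_and, not_not]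
      rcases h2 with h | h | h
      · exact Or.inl h
      · refine Or.inr (Or.inl fun a ha => ?_)
        by_contra hc
        obtain ⟨k, hk, hk'⟩ := hu a (by omega)
        apply ha
        rw [hk]
        exact h k (by omega)
      · refine Or.inr (Or.inr fun a ha => ?_)
        by_contra hc
        push Not at hc
        obtain ⟨k, hk, hk'⟩ := hu a (by omega)
        apply ha
        rw [hk]
        exact h k (by omega)
    · intro v hv
      simpa using hv
    · rw [Finset.sum_filter_ne_zero, hsum]

/-- The forward map. -/
noncomputable def fwd (n J : ℕ) (g : Fin (n + (J + 1)) → ℝ) : EuclideanSpace ℝ (Fin (n + 1)) :=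
  WithLp.toLp 2 (Fin.snoc (α := fun _ => ℝ) (fun i => g (Fin.castAdd (J + 1) i))
    (∑ k : Fin (J + 1), (k.val / J : ℝ) * g (Fin.natAdd n k)))

/-- The backward map. -/
noncomputable def bwd (n J : ℕ) (x : EuclideanSpace ℝ (Fin (n + 1))) : Fin (n + (J + 1)) → ℝ :=
  Fin.append (fun i : Fin n => x i.castSucc)
    (fun k : Fin (J + 1) => max 0 ((1 - ∑ i : Fin n, x i.castSucc)
      - |J * x (Fin.last n) - k.val * (1 - ∑ i : Fin n, x i.castSucc)|))

theorem fwd_castSucc (n J : ℕ) (g) (i : Fin n) :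
    fwd n J g i.castSucc = g (Fin.castAdd (J + 1) i) := by
  simp [fwd]

theorem fwd_last (n J : ℕ) (g) : fwd n J g (Fin.last n) =
    ∑ k : Fin (J + 1), (k.val / J : ℝ) * g (Fin.natAdd n k) := by
  simp [fwd]

theorem bwd_left (n J : ℕ) (x) (i : Fin n) :
    bwd n J x (Fin.castAdd (J + 1) i) = x i.castSucc := by
  simp [bwd]

theorem bwd_right (n J : ℕ) (x) (k : Fin (J + 1)) :
    bwd n J x (Fin.natAdd n k) = max 0 ((1 - ∑ i : Fin n, x i.castSucc)
      - |J * x (Fin.last n) - k.val * (1 - ∑ i : Fin n, x i.castSucc)|) := by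
  simp [bwd]

theorem fwd_continuous (n J : ℕ) : Continuous (fwd n J) := by
  refine (PiLp.continuous_toLp 2 _).comp (continuous_pi fun i => ?_)
  refine Fin.lastCases ?_ (fun i => ?_) i
  · simp only [Fin.snoc_last]; fun_prop
  · simp only [Fin.snoc_castSucc]; fun_prop

theorem bwd_continuous (n J : ℕ) : Continuous (bwd n J) := by
  refine continuous_pi fun i => ?_
  refine Fin.addCases (fun i => ?_) (fun k => ?_) i
  · simp only [bwd_left]; fun_prop
  · simp only [bwd_right]; fun_prop

/-- Sums over the path concentrated on a segment. -/
theorem sum_seg (J j : ℕ) (hj : j < J) (F : Fin (J + 1) → ℝ)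
    (hF : ∀ k : Fin (J + 1), k.val ≠ j → k.val ≠ j + 1 → F k = 0) :
    ∑ k, F k = F ⟨j, by omega⟩ + F ⟨j + 1, by omega⟩ := by
  apply Fintype.sum_eq_add
  · simp
  · rintro k ⟨h1, h2⟩
    exact hF k (fun h => h1 (Fin.ext h)) (fun h => h2 (Fin.ext h))

theorem bwd_fwd (n J : ℕ) (hJ : 1 ≤ J) (g) (hg : g ∈ (Kc n J).realization) :
    bwd n J (fwd n J g) = g := by
  obtain ⟨h0, hsum, j, hj, h1, -⟩ := (mem_real_iff n J g).mp hg
  have hJ' : (J : ℝ) ≠ 0 := by positivity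
  rw [Fin.sum_univ_add, sum_seg J j hj _ h1] at hsum
  have hq := fwd_last n J g
  rw [sum_seg J j hj _ (fun k hk hk' => by rw [h1 k hk hk', mul_zero])] at hq
  set A := g (Fin.natAdd n ⟨j, by omega⟩) with hA
  set B := g (Fin.natAdd n ⟨j + 1, by omega⟩) with hB
  have hA0 : 0 ≤ A := h0 _
  have hB0 : 0 ≤ B := h0 _
  have hq' : J * fwd n J g (Fin.last n) = j * A + (j + 1) * B := by
    rw [hq]; push_cast; field_simp
  have hr : 1 - ∑ i : Fin n, fwd n J g i.castSucc = A + B := by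
    simp only [fwd_castSucc]; linarith
  funext v
  refine Fin.addCases (fun i => ?_) (fun k => ?_) v
  · rw [bwd_left, fwd_castSucc]
  · rw [bwd_right, hr, hq']
    by_cases hk : k.val = j
    · have : k = ⟨j, by omega⟩ := Fin.ext hk
      rw [this, ← hA]
      simp only
      rw [show (j * A + (j + 1) * B - j * (A + B) : ℝ) = B by ring, abs_of_nonneg hB0,
        add_sub_cancel_right, max_eq_right hA0]
    by_cases hk' : k.val = j + 1
    · have : k = ⟨j + 1, by omega⟩ := Fin.ext hk'
      rw [this, ← hB]
      simp only
      push_cast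
      rw [show (j * A + (j + 1) * B - (j + 1) * (A + B) : ℝ) = -A by ring, abs_neg,
        abs_of_nonneg hA0, add_sub_cancel_left, max_eq_right hB0]
    rw [h1 k hk hk', max_eq_left]
    rcases lt_or_gt_of_ne hk with h | h
    · have : (k.val : ℝ) + 1 ≤ j := by exact_mod_cast h
      have h3 := le_abs_self (j * A + (j + 1) * B - k.val * (A + B) : ℝ)
      nlinarith
    · have : (j : ℝ) + 2 ≤ k.val := by
        have : j + 2 ≤ k.val := by omega
        exact_mod_cast this
      have h3 := neg_le_abs (j * A + (j + 1) * B - k.val * (A + B) : ℝ)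
      nlinarith

theorem fwd_mem (n J : ℕ) (hJ : 1 ≤ J) (g) (hg : g ∈ (Kc n J).realization) :
    fwd n J g ∈ frontier (corner n) := by
  obtain ⟨h0, hsum, j, hj, h1, h2⟩ := (mem_real_iff n J g).mp hg
  have hJ' : (0 : ℝ) < J := by positivity
  rw [corner_frontier]
  rw [Fin.sum_univ_add] at hsum
  have hw : ∀ k : Fin (J + 1), (k.val / J : ℝ) ≤ 1 := by
    intro k
    rw [div_le_one hJ']
    exact_mod_cast (by omega : k.val ≤ J)
  simp only [Set.mem_ofPred_eq]
  refine ⟨fun i => ?_, ?_, ?_⟩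
  · refine Fin.lastCases ?_ (fun i => ?_) i
    · rw [fwd_last]
      exact Finset.sum_nonneg fun k _ => mul_nonneg (by positivity) (h0 _)
    · rw [fwd_castSucc]; exact h0 _
  · rw [Fin.sum_univ_castSucc, fwd_last, ← hsum]
    simp only [fwd_castSucc]
    gcongr with k
    exact mul_le_of_le_one_left (h0 _) (hw k)
  · rcases h2 with ⟨i, hi⟩ | h | h
    · exact Or.inl ⟨i.castSucc, by rw [fwd_castSucc, hi]⟩
    · refine Or.inl ⟨Fin.last n, ?_⟩
      rw [fwd_last]
      refine Finset.sum_eq_zero fun k _ => ?_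
      by_cases hk : k.val = 0
      · simp [hk]
      · rw [h k hk, mul_zero]
    · right
      rw [Fin.sum_univ_castSucc, fwd_last, ← hsum]
      simp only [fwd_castSucc]
      congr 1
      refine Finset.sum_congr rfl fun k _ => ?_
      by_cases hk : k.val = J
      · rw [hk, div_self hJ'.ne', one_mul]
      · rw [h k hk, mul_zero]

theorem bwd_spec (n J : ℕ) (hJ : 1 ≤ J) (x) (hx : x ∈ frontier (corner n)) :
    bwd n J x ∈ (Kc n J).realization ∧ fwd n J (bwd n J x) = x := by
  rw [corner_frontier] at hx
  obtain ⟨h0, h1, h2⟩ := hx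
  have hJ' : (0 : ℝ) < J := by positivity
  rw [Fin.sum_univ_castSucc] at h1 h2
  have hr := bwd_right n J x
  set r := 1 - ∑ i : Fin n, x i.castSucc with hrdef
  set q := x (Fin.last n) with hqdef
  have hq0 : 0 ≤ q := h0 _
  have hqr : q ≤ r := by linarith
  obtain ⟨j, hj, hj1, hj2⟩ := exists_seg J hJ (J * q) r (by positivity) (by gcongr)
  have hr0 : 0 ≤ r := by linarith
  have hsupp : ∀ k : Fin (J + 1), k.val ≠ j → k.val ≠ j + 1 → bwd n J x (Fin.natAdd n k) = 0 := by
    intro k hk hk'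
    rw [hr, max_eq_left]
    rcases lt_or_gt_of_ne hk with h | h
    · have : (k.val : ℝ) + 1 ≤ j := by exact_mod_cast h
      have h3 := le_abs_self (J * q - k.val * r : ℝ)
      nlinarith
    · have : (j : ℝ) + 2 ≤ k.val := by
        have : j + 2 ≤ k.val := by omega
        exact_mod_cast this
      have h3 := neg_le_abs (J * q - k.val * r : ℝ)
      nlinarith
  have hA : bwd n J x (Fin.natAdd n ⟨j, by omega⟩) = (j + 1) * r - J * q := by
    rw [hr]
    simp only
    rw [abs_of_nonneg (by linarith), max_eq_right (by linarith)]
    ring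
  have hB : bwd n J x (Fin.natAdd n ⟨j + 1, by omega⟩) = J * q - j * r := by
    rw [hr]
    push_cast
    rw [abs_of_nonpos (by linarith), max_eq_right (by linarith)]
    ring
  constructor
  · rw [mem_real_iff]
    refine ⟨?_, ?_, j, hj, hsupp, ?_⟩
    · intro v
      refine Fin.addCases (fun i => ?_) (fun k => ?_) v
      · rw [bwd_left]; exact h0 _
      · rw [hr]; exact le_max_left _ _
    · rw [Fin.sum_univ_add, sum_seg J j hj _ hsupp, hA, hB]
      simp only [bwd_left]
      rw [hrdef]; ring
    · rcases h2 with ⟨i, hi⟩ | h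
      · revert hi
        refine Fin.lastCases (fun hi => ?_) (fun i hi => ?_) i
        · right; left
          intro k hk
          have : (1 : ℝ) ≤ k.val := by exact_mod_cast (by omega : 1 ≤ k.val)
          have hi' : q = 0 := hi
          rw [hr, hi', max_eq_left]
          have h3 := neg_le_abs (J * 0 - k.val * r : ℝ)
          nlinarith
        · left
          exact ⟨i, by rw [bwd_left, hi]⟩
      · right; right
        intro k hk
        have : (k.val : ℝ) + 1 ≤ J := by exact_mod_cast (by omega : k.val + 1 ≤ J)
        have hq : q = r := by linarith
        rw [hr, hq, max_eq_left]
        have h3 := le_abs_self (J * r - k.val * r : ℝ)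
        nlinarith
  · ext i
    refine Fin.lastCases ?_ (fun i => ?_) i
    · rw [fwd_last, sum_seg J j hj _ (fun k hk hk' => by rw [hsupp k hk hk', mul_zero]), hA, hB,
        ← hqdef]
      push_cast
      field_simp
      ring
    · rw [fwd_castSucc, bwd_left]

theorem Kc_sphere (n J : ℕ) (hJ : 1 ≤ J) : (Kc n J).IsSphereTriangulation n := by
  obtain ⟨e⟩ := corner_sphere n
  let e' : (Kc n J).realization ≃ₜ frontier (corner n) :=
    { toFun := fun g => ⟨fwd n J g, fwd_mem n J hJ g g.2⟩
      invFun := fun x => ⟨bwd n J x, (bwd_spec n J hJ x x.2).1⟩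
      left_inv := fun g => Subtype.ext (bwd_fwd n J hJ g g.2)
      right_inv := fun x => Subtype.ext (bwd_spec n J hJ x x.2).2
      continuous_toFun := by
        exact ((fwd_continuous n J).comp continuous_subtype_val).subtype_mk _
      continuous_invFun := by
        exact ((bwd_continuous n J).comp continuous_subtype_val).subtype_mk _ }
  exact ⟨e'.trans e⟩

/-! ## Boundary chains of simplices -/

/-- The boundary chain of the (possibly degenerate) simplex `g`. -/
def chain {W : Type*} [DecidableEq W] {n : ℕ} (g : Fin (n + 2) → W) (x : Fin (n + 1) → W) : ℤ :=
  ∑ σ : Equiv.Perm (Fin (n + 2)),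
    if (fun i : Fin (n + 1) => g (σ i.succ)) = x then (Equiv.Perm.sign σ : ℤ) else 0

section chain
variable {W : Type*} [DecidableEq W] {n : ℕ}

theorem chain_perm (g : Fin (n + 2) → W) (x : Fin (n + 1) → W) (τ : Equiv.Perm (Fin (n + 1))) :
    chain g (x ∘ τ) = (Equiv.Perm.sign τ : ℤ) * chain g x := by
  unfold chain
  set t : Equiv.Perm (Fin (n + 2)) := Equiv.Perm.decomposeFin.symm (0, τ) with ht
  have hts : ∀ i : Fin (n + 1), t i.succ = (τ i).succ := by
    intro i
    rw [ht, Equiv.Perm.decomposeFin_symm_apply_succ]; simp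
  have hsign : Equiv.Perm.sign t = Equiv.Perm.sign τ := by
    rw [ht, Equiv.Perm.decomposeFin.symm_sign]; simp
  rw [Finset.mul_sum, ← Equiv.sum_comp (Equiv.mulRight t)]
  refine Finset.sum_congr rfl fun σ _ => ?_
  have hiff : ((fun i : Fin (n + 1) => g ((Equiv.mulRight t σ) i.succ)) = x ∘ τ) ↔
      (fun i : Fin (n + 1) => g (σ i.succ)) = x := by
    constructor
    · intro h
      funext i
      have := congrFun h (τ.symm i)
      simpa [hts] using this
    · intro h
      funext i
      simp [hts, ← h]
  by_cases h : (fun i : Fin (n + 1) => g (σ i.succ)) = x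
  · rw [if_pos (hiff.mpr h), if_pos h]
    simp [hsign, mul_comm]
  · rw [if_neg (fun h' => h (hiff.mp h')), if_neg h, mul_zero]

theorem chain_degen (g : Fin (n + 2) → W) (x : Fin (n + 1) → W) (a b : Fin (n + 2)) (hab : a ≠ b)
    (hg : g a = g b) : chain g x = 0 := by
  have hsw : ∀ c, g (Equiv.swap a b c) = g c := by
    intro c
    rw [Equiv.swap_apply_def]
    split_ifs with h1 h2
    · rw [h1, hg]
    · rw [h2, hg]
    · rfl
  have key : chain g x = - chain g x := by
    conv_lhs => unfold chain
    rw [← Equiv.sum_comp (Equiv.mulLeft (Equiv.swap a b))]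
    unfold chain
    rw [← Finset.sum_neg_distrib]
    refine Finset.sum_congr rfl fun σ _ => ?_
    simp only [Equiv.coe_mulLeft, Equiv.Perm.mul_apply, hsw, Equiv.Perm.sign_mul,
      Equiv.Perm.sign_swap hab]
    split_ifs <;> simp
  omega

theorem chain_push {V : Type*} [Fintype V] [DecidableEq V] (g : Fin (n + 2) → V) (f : V → W)
    (y : Fin (n + 1) → W) : algSum (chain g) f y = chain (f ∘ g) y := by
  classical
  unfold algSum chain
  simp only [← Finset.sum_filter]
  rw [Finset.sum_comm' (t' := Finset.univ.filter
    (fun σ : Equiv.Perm (Fin (n+2)) => (fun i : Fin (n + 1) => (f ∘ g) (σ i.succ)) = y))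
    (s' := fun σ => {fun i : Fin (n + 1) => g (σ i.succ)})]
  · simp
  · intro x σ
    simp only [Finset.mem_filter, Finset.mem_univ, true_and, Finset.mem_singleton]
    constructor
    · rintro ⟨rfl, rfl⟩
      exact ⟨rfl, rfl⟩
    · rintro ⟨rfl, rfl⟩
      exact ⟨rfl, rfl⟩

theorem chain_id (σ : Equiv.Perm (Fin (n + 2))) :
    chain id (fun i : Fin (n + 1) => σ i.succ) = (Equiv.Perm.sign σ : ℤ) := by
  unfold chain
  rw [Finset.sum_eq_single σ]
  · simp
  · intro τ _ hτ
    rw [if_neg]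
    intro h
    apply hτ
    have hs : ∀ i : Fin (n + 1), τ i.succ = σ i.succ := fun i => congrFun h i
    ext1 c
    refine Fin.cases ?_ hs c
    obtain ⟨d, hd⟩ := σ.surjective (τ 0)
    revert hd
    refine Fin.cases (fun hd => hd.symm) (fun i hd => ?_) d
    rw [← hs] at hd
    exact absurd (τ.injective hd) (Fin.succ_ne_zero i)
  · simp

theorem exists_perm (p : Fin (n + 1) → Fin (n + 2)) (hp : Function.Injective p) :
    ∃ σ : Equiv.Perm (Fin (n + 2)), p = fun i => σ i.succ := by
  obtain ⟨w, hw⟩ : ∃ w, w ∉ Set.range p := by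
    by_contra hc
    push Not at hc
    have := Fintype.card_le_of_surjective p hc
    simp at this
  have hinj : Function.Injective (Fin.cons w p : Fin (n + 2) → Fin (n + 2)) :=
    Fin.cons_injective_iff.mpr ⟨hw, hp⟩
  refine ⟨Equiv.ofBijective _ (Finite.injective_iff_bijective.mp hinj), ?_⟩
  funext i
  simp

theorem chain_unit (p : Fin (n + 1) → Fin (n + 2)) (hp : Function.Injective p) :
    chain id p = 1 ∨ chain id p = -1 := by
  obtain ⟨σ, rfl⟩ := exists_perm p hp
  rw [chain_id]
  rcases Int.units_eq_one_or (Equiv.Perm.sign σ) with h | h <;> simp [h]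

theorem chain_zero (g : Fin (n + 2) → W) (x : Fin (n + 1) → W) (i : Fin (n + 1))
    (h : ∀ c, g c ≠ x i) : chain g x = 0 := by
  unfold chain
  refine Finset.sum_eq_zero fun σ _ => if_neg fun h' => h _ (congrFun h' i)

theorem chain_comp (g : Fin (n + 2) → W) (hg : Function.Injective g)
    (p : Fin (n + 1) → Fin (n + 2)) : chain g (g ∘ p) = chain id p := by
  unfold chain
  refine Finset.sum_congr rfl fun σ _ => ?_
  congr 1
  simp only [funext_iff, Function.comp, hg.eq_iff, id]

theorem chain_noninj (g : Fin (n + 2) → W) (hg : Function.Injective g)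
    (x : Fin (n + 1) → W) (hx : ¬ Function.Injective x) : chain g x = 0 := by
  unfold chain
  refine Finset.sum_eq_zero fun σ _ => if_neg fun h' => hx ?_
  rw [← h']
  exact hg.comp (σ.injective.comp (Fin.succ_injective _))

theorem exists_of_chain (g : Fin (n + 2) → W) (x : Fin (n + 1) → W) (h : chain g x ≠ 0) :
    ∃ p, x = g ∘ p := by
  have : ∀ i, ∃ c, g c = x i := by
    intro i
    by_contra hc
    push Not at hc
    exact h (chain_zero g x i hc)
  choose p hp using this
  exact ⟨p, funext fun i => (hp i).symm⟩

theorem chain_coh (p q : Fin (n + 1) → Fin (n + 2)) (hp : Function.Injective p)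
    (hq : Function.Injective q) (i : Fin (n + 1)) (hi : p i ≠ q i)
    (h : ∀ j, j ≠ i → p j = q j) : chain id q = - chain id p := by
  obtain ⟨σ, hσ⟩ := exists_perm p hp
  have hq' : q = fun j => (Equiv.swap (p i) (q i) * σ) j.succ := by
    funext j
    rw [Equiv.Perm.mul_apply, ← congrFun hσ j]
    by_cases hj : j = i
    · rw [hj, Equiv.swap_apply_left]
    · rw [Equiv.swap_apply_of_ne_of_ne, h j hj]
      · exact fun h' => hj (hp h')
      · rw [h j hj]
        exact fun h' => hj (hq h')
  rw [hq', chain_id, Equiv.Perm.sign_mul, Equiv.Perm.sign_swap hi, hσ, chain_id]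
  simp

end chain

/-- Orientation of the standard sphere. -/
def oStd (n : ℕ) : CoherentOrientation n (stdSphere n) where
  sign := chain id
  sign_perm := chain_perm id
  sign_unit := fun x hx _ => chain_unit x hx
  sign_zero := by
    rintro x (hx | hx)
    · exact chain_noninj id Function.injective_id x hx
    · exfalso
      apply hx
      refine ⟨by simp, fun h => ?_⟩
      have h1 := congrArg Finset.card h
      have h2 := Finset.card_image_le (s := (Finset.univ : Finset (Fin (n + 1)))) (f := x)
      simp at h1 h2
      omega
  coherent := by
    rintro x y ⟨i, hi, h⟩ hx hy
    refine chain_coh x y ?_ ?_ i hi h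
    · by_contra hc
      exact hx (chain_noninj id Function.injective_id x hc)
    · by_contra hc
      exact hy (chain_noninj id Function.injective_id y hc)

/-- The `j`-th top simplex of the stacked ball. -/
def phi (n J : ℕ) (j : Fin J) (c : Fin (n + 2)) : Fin (n + (J + 1)) :=
  ⟨if c.val < n then c.val else c.val + j.val, by split_ifs <;> omega⟩

theorem phi_val (n J : ℕ) (j : Fin J) (c : Fin (n + 2)) :
    (phi n J j c).val = if c.val < n then c.val else c.val + j.val := rfl

theorem phi_inj (n J : ℕ) (j : Fin J) : Function.Injective (phi n J j) := by
  intro a b h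
  have := congrArg Fin.val h
  simp only [phi_val] at this
  ext
  split_ifs at this <;> omega

/-- The fundamental cycle. -/
def sg (n J : ℕ) (x : Fin (n + 1) → Fin (n + (J + 1))) : ℤ := ∑ j : Fin J, chain (phi n J j) x

/-- `p` describes a boundary facet of the `j`-th simplex. -/
def Good (n J : ℕ) (j : Fin J) (p : Fin (n + 1) → Fin (n + 2)) : Prop :=
  (∃ i i', (p i).val = n ∧ (p i').val = n + 1) ∨ (j.val = 0 ∧ ∃ i, (p i).val = n) ∨
    (j.val + 1 = J ∧ ∃ i, (p i).val = n + 1)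

theorem sg_good (n J : ℕ) (j : Fin J) (p : Fin (n + 1) → Fin (n + 2)) (hg : Good n J j p) :
    sg n J (phi n J j ∘ p) = chain id p := by
  unfold sg
  rw [Finset.sum_eq_single j, chain_comp _ (phi_inj n J j)]
  · intro k _ hk
    have hk' : k.val ≠ j.val := fun h => hk (Fin.ext h)
    have hc : ∀ i (P : Prop), (∀ c, phi n J k c = phi n J j (p i) →
        (n ≤ (p i).val → (c.val + k.val = (p i).val + j.val ∧ n ≤ c.val)) → P) →
        (∀ c, phi n J k c = phi n J j (p i) → P) := by
      intro i P h c hc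
      refine h c hc fun hi => ?_
      have := congrArg Fin.val hc
      simp only [phi_val] at this
      split_ifs at this <;> omega
    rcases hg with ⟨i, i', h1, h2⟩ | ⟨h0, i, h1⟩ | ⟨h0, i, h1⟩
    · rcases lt_or_gt_of_ne hk' with h | h
      · refine chain_zero _ _ i' (hc i' False fun c _ h' => ?_)
        have := h' (by omega)
        omega
      · refine chain_zero _ _ i (hc i False fun c _ h' => ?_)
        have := h' (by omega)
        omega
    · refine chain_zero _ _ i (hc i False fun c _ h' => ?_)
      have := h' (by omega)
      omega
    · refine chain_zero _ _ i (hc i False fun c _ h' => ?_)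
      have := h' (by omega)
      omega
  · simp

/-- An injective map into `Fin (n+2)` misses only one element. -/
theorem missing (n : ℕ) (p : Fin (n + 1) → Fin (n + 2)) (hp : Function.Injective p) :
    ∃ w, ∀ c, c ≠ w → ∃ i, p i = c := by
  obtain ⟨σ, rfl⟩ := exists_perm p hp
  refine ⟨σ 0, fun c hc => ?_⟩
  obtain ⟨d, rfl⟩ := σ.surjective c
  revert hc
  refine Fin.cases (fun h => absurd rfl h) (fun i _ => ⟨i, rfl⟩) d

theorem missing_not (n : ℕ) (p : Fin (n + 1) → Fin (n + 2))
    (h : ∀ c, ∃ i, p i = c) : False := by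
  have := Fintype.card_le_of_surjective p h
  simp at this

theorem face_good (n J : ℕ) (j : Fin J) (p : Fin (n + 1) → Fin (n + 2))
    (hp : Function.Injective p) (hg : Good n J j p) :
    Finset.image (phi n J j ∘ p) Finset.univ ∈ (Kc n J).faces := by
  obtain ⟨w, hw⟩ := missing n p hp
  have hwn : ∀ i, p i ≠ w := by
    intro i hi
    refine missing_not n p fun c => ?_
    by_cases hc : c = w
    · exact ⟨i, by rw [hi, hc]⟩
    · exact hw c hc
  refine ⟨by simp, j.val, j.isLt, ?_, ?_⟩
  · simp only [Finset.mem_image, Finset.mem_univ, true_and, forall_exists_index,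
      forall_apply_eq_imp_iff, Function.comp, phi_val]
    intro i
    split_ifs <;> omega
  · by_cases hwlt : w.val < n
    · left
      refine ⟨⟨w.val, hwlt⟩, ?_⟩
      simp only [Finset.mem_image, Finset.mem_univ, true_and, Function.comp, not_exists]
      intro i hi
      apply hwn i
      have := congrArg Fin.val hi
      simp only [phi_val, Fin.val_castAdd] at this
      ext
      split_ifs at this <;> omega
    · right
      have hval : ∀ i, (p i).val ≠ w.val := fun i h => hwn i (Fin.ext h)
      simp only [Finset.mem_image, Finset.mem_univ, true_and, forall_exists_index,
        forall_apply_eq_imp_iff, Function.comp, phi_val]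
      rcases hg with ⟨i, i', h1, h2⟩ | ⟨h0, i, h1⟩ | ⟨h0, i, h1⟩
      · have := hval i; have := hval i'; omega
      · left
        intro l
        have := hval i; have := hval l
        split_ifs <;> omega
      · right
        intro l
        have := hval i; have := hval l
        split_ifs <;> omega

theorem hit (n : ℕ) (p : Fin (n + 1) → Fin (n + 2)) (hp : Function.Injective p) (c₀ : ℕ)
    (h0 : c₀ < n + 2) (h : ∀ i, (p i).val ≠ c₀) (c : ℕ) (hc : c < n + 2) (hcc : c ≠ c₀) :
    ∃ i, (p i).val = c := by
  obtain ⟨w, hw⟩ := missing n p hp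
  have : w = ⟨c₀, h0⟩ := by
    by_contra hne
    obtain ⟨i, hi⟩ := hw ⟨c₀, h0⟩ (Ne.symm hne)
    exact h i (congrArg Fin.val hi)
  obtain ⟨i, hi⟩ := hw ⟨c, hc⟩ (by rw [this]; intro h'; exact hcc (congrArg Fin.val h'))
  exact ⟨i, congrArg Fin.val hi⟩

theorem lift_phi (n J : ℕ) (j : Fin J) (x : Fin (n + 1) → Fin (n + (J + 1)))
    (hx : Function.Injective x)
    (h : ∀ i, (x i).val < n ∨ (x i).val = n + j.val ∨ (x i).val = n + j.val + 1) :
    ∃ p, x = phi n J j ∘ p ∧ Function.Injective p := by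
  have h1 : ∀ i, ∃ c, phi n J j c = x i := by
    intro i
    by_cases hi : (x i).val < n
    · refine ⟨⟨(x i).val, by omega⟩, Fin.ext ?_⟩
      simp only [phi_val, if_pos hi]
    · refine ⟨⟨(x i).val - j.val, by have := h i; omega⟩, Fin.ext ?_⟩
      have := h i
      simp only [phi_val]
      split_ifs <;> omega
  choose p hp using h1
  have hxp : x = phi n J j ∘ p := funext fun i => (hp i).symm
  refine ⟨p, hxp, ?_⟩
  rw [hxp] at hx
  exact hx.of_comp

theorem good_face (n J : ℕ) (x : Fin (n + 1) → Fin (n + (J + 1))) (hx : Function.Injective x)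
    (hf : Finset.image x Finset.univ ∈ (Kc n J).faces) :
    ∃ j p, x = phi n J j ∘ p ∧ Function.Injective p ∧ Good n J j p := by
  obtain ⟨-, j, hj, h1, h2⟩ := hf
  simp only [Finset.mem_image, Finset.mem_univ, true_and, forall_exists_index,
    forall_apply_eq_imp_iff, not_exists] at h1 h2
  rcases h2 with ⟨a, ha⟩ | h | h
  · obtain ⟨p, hxp, hp⟩ := lift_phi n J ⟨j, hj⟩ x hx h1
    refine ⟨⟨j, hj⟩, p, hxp, hp, Or.inl ?_⟩
    have hm : ∀ i, (p i).val ≠ a.val := by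
      intro i hi
      apply ha i
      ext
      rw [hxp]
      have := a.isLt
      simp only [Function.comp, phi_val, Fin.val_castAdd]
      split_ifs <;> omega
    obtain ⟨i, hi⟩ := hit n p hp a.val (by omega) hm n (by omega) (by omega)
    obtain ⟨i', hi'⟩ := hit n p hp a.val (by omega) hm (n + 1) (by omega) (by omega)
    exact ⟨i, i', hi, hi'⟩
  · obtain ⟨p, hxp, hp⟩ := lift_phi n J ⟨0, by omega⟩ x hx (fun i => by have := h i; simp; omega)
    refine ⟨⟨0, by omega⟩, p, hxp, hp, Or.inr (Or.inl ⟨rfl, ?_⟩)⟩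
    refine hit n p hp (n + 1) (by omega) (fun i hi => ?_) n (by omega) (by omega)
    have := h i
    simp only [hxp, Function.comp, phi_val] at this
    split_ifs at this <;> omega
  · obtain ⟨p, hxp, hp⟩ := lift_phi n J ⟨J - 1, by omega⟩ x hx
      (fun i => by have := h i; simp; omega)
    refine ⟨⟨J - 1, by omega⟩, p, hxp, hp, Or.inr (Or.inr ⟨by simp only; omega, ?_⟩)⟩
    refine hit n p hp n (by omega) (fun i hi => ?_) (n + 1) (by omega) (by omega)
    have := h i
    simp only [hxp, Function.comp, phi_val] at this
    split_ifs at this <;> omega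

/-- Interior walls cancel. -/
theorem sg_cancel (n J : ℕ) (j k : Fin J) (hk : k.val = j.val + 1)
    (p q : Fin (n + 1) → Fin (n + 2)) (hp : Function.Injective p) (hq : Function.Injective q)
    (i : Fin (n + 1)) (hpi : (p i).val = n + 1) (hqi : (q i).val = n)
    (hpq : ∀ l, l ≠ i → p l = q l ∧ (p l).val < n) :
    sg n J (phi n J j ∘ p) = 0 := by
  have heq : phi n J j ∘ p = phi n J k ∘ q := by
    funext l
    ext
    simp only [Function.comp, phi_val]
    by_cases hl : l = i
    · subst hl
      split_ifs <;> omega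
    · obtain ⟨h1, h2⟩ := hpq l hl
      rw [← h1, if_pos h2, if_pos h2]
  have hjk : j ≠ k := fun h => by rw [h] at hk; omega
  unfold sg
  rw [Fintype.sum_eq_add j k hjk, chain_comp _ (phi_inj n J j), heq,
    chain_comp _ (phi_inj n J k),
    chain_coh p q hp hq i (fun h => by rw [h] at hpi; omega) (fun l hl => (hpq l hl).1)]
  · ring
  · rintro l ⟨h1, h2⟩
    have h1' : l.val ≠ j.val := fun h => h1 (Fin.ext h)
    have h2' : l.val ≠ k.val := fun h => h2 (Fin.ext h)
    refine chain_zero _ _ i fun c hc => ?_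
    have := congrArg Fin.val hc
    simp only [Function.comp, phi_val] at this
    split_ifs at this <;> omega

theorem update_inj (n : ℕ) (p : Fin (n + 1) → Fin (n + 2)) (hp : Function.Injective p)
    (i : Fin (n + 1)) (c : Fin (n + 2)) (hc : ∀ l, p l ≠ c) :
    Function.Injective (Function.update p i c) := by
  intro a b hab
  simp only [Function.update_apply] at hab
  split_ifs at hab with h1 h2 h2
  · rw [h1, h2]
  · exact absurd hab.symm (hc b)
  · exact absurd hab (hc a)
  · exact hp hab

theorem sg_cases (n J : ℕ) (x : Fin (n + 1) → Fin (n + (J + 1))) (hx : sg n J x ≠ 0) :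
    ∃ j p, x = phi n J j ∘ p ∧ Function.Injective p ∧ Good n J j p := by
  obtain ⟨j, -, hj⟩ := Finset.exists_ne_zero_of_sum_ne_zero hx
  obtain ⟨p, hxp⟩ := exists_of_chain _ _ hj
  have hp : Function.Injective p := by
    by_contra hc
    refine hj (chain_noninj _ (phi_inj n J j) _ fun h => hc ?_)
    rw [hxp] at h
    exact h.of_comp
  refine ⟨j, p, hxp, hp, ?_⟩
  by_contra hg
  apply hx
  rw [hxp]
  by_cases hn : ∀ i, (p i).val ≠ n
  · obtain ⟨i, hi⟩ := hit n p hp n (by omega) hn (n + 1) (by omega) (by omega)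
    have hjJ : j.val + 1 ≠ J := fun h => hg (Or.inr (Or.inr ⟨h, i, hi⟩))
    refine sg_cancel n J j ⟨j.val + 1, by omega⟩ rfl p (Function.update p i ⟨n, by omega⟩) hp
      (update_inj n p hp i _ fun l h => hn l (congrArg Fin.val h)) i hi (by simp) fun l hl => ?_
    refine ⟨by rw [Function.update_of_ne hl], ?_⟩
    have h1 := hn l
    have h2 : (p l).val ≠ n + 1 := fun h => hl (hp (Fin.ext (by rw [h, hi])))
    omega
  · push Not at hn
    obtain ⟨i, hi⟩ := hn
    have hj0 : j.val ≠ 0 := fun h => hg (Or.inr (Or.inl ⟨h, i, hi⟩))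
    have hn1 : ∀ l, (p l).val ≠ n + 1 := fun l hl => hg (Or.inl ⟨i, l, hi, hl⟩)
    have hu := update_inj n p hp i ⟨n + 1, by omega⟩ fun l h => hn1 l (congrArg Fin.val h)
    have hlt : ∀ l, l ≠ i → (p l).val < n := by
      intro l hl
      have h1 := hn1 l
      have h2 : (p l).val ≠ n := fun h => hl (hp (Fin.ext (by rw [h, hi])))
      omega
    have heq : phi n J j ∘ p = phi n J ⟨j.val - 1, by omega⟩ ∘
        (Function.update p i ⟨n + 1, by omega⟩) := by
      funext l
      ext
      simp only [Function.comp, phi_val]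
      by_cases hl : l = i
      · subst hl
        simp only [Function.update_self]
        split_ifs <;> omega
      · rw [Function.update_of_ne hl, if_pos (hlt l hl), if_pos (hlt l hl)]
    rw [heq]
    refine sg_cancel n J _ j (by simp only; omega) _ p hu hp i (by simp) hi fun l hl => ?_
    rw [Function.update_of_ne hl]
    exact ⟨rfl, hlt l hl⟩

theorem sg_perm (n J : ℕ) (x : Fin (n + 1) → Fin (n + (J + 1))) (σ : Equiv.Perm (Fin (n + 1))) :
    sg n J (x ∘ σ) = (Equiv.Perm.sign σ : ℤ) * sg n J x := by
  unfold sg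
  rw [Finset.mul_sum]
  exact Finset.sum_congr rfl fun j _ => chain_perm _ _ _

theorem coh_aux (n J : ℕ) (j k : Fin J) (p q : Fin (n + 1) → Fin (n + 2))
    (hp : Function.Injective p) (hq : Function.Injective q) (hgp : Good n J j p)
    (hgq : Good n J k q) (i : Fin (n + 1)) (hjk : j.val < k.val)
    (h : ∀ l, l ≠ i → (phi n J j ∘ p) l = (phi n J k ∘ q) l) :
    chain id q = - chain id p := by
  have hv : ∀ l, l ≠ i → ((p l).val < n ∧ p l = q l) ∨
      (k.val = j.val + 1 ∧ (p l).val = n + 1 ∧ (q l).val = n) := by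
    intro l hl
    have := congrArg Fin.val (h l hl)
    simp only [Function.comp, phi_val] at this
    have hpl := (p l).isLt
    have hql := (q l).isLt
    split_ifs at this with h1 h2 h2
    · exact Or.inl ⟨h1, Fin.ext this⟩
    · omega
    · omega
    · right; omega
  have hk := k.isLt
  have hpn : ∃ l, (p l).val = n := by
    rcases hgp with ⟨l, l', h1, h2⟩ | ⟨h0, l, h1⟩ | ⟨h0, l, h1⟩
    · exact ⟨l, h1⟩
    · exact ⟨l, h1⟩
    · omega
  have hqn : ∃ l, (q l).val = n + 1 := by
    rcases hgq with ⟨l, l', h1, h2⟩ | ⟨h0, l, h1⟩ | ⟨h0, l, h1⟩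
    · exact ⟨l', h2⟩
    · omega
    · exact ⟨l, h1⟩
  have hpi : (p i).val = n := by
    obtain ⟨l, hl⟩ := hpn
    by_cases hli : l = i
    · rw [← hli, hl]
    · rcases hv l hli with h | h <;> omega
  have hqi : (q i).val = n + 1 := by
    obtain ⟨l, hl⟩ := hqn
    by_cases hli : l = i
    · rw [← hli, hl]
    · rcases hv l hli with ⟨h, h'⟩ | h
      · rw [h'] at h; omega
      · omega
  by_cases hex : ∃ l, l ≠ i ∧ (p l).val = n + 1
  · obtain ⟨l, hli, hl⟩ := hex
    have hql : (q l).val = n := by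
      rcases hv l hli with h | h <;> omega
    have : q = p ∘ Equiv.swap i l := by
      funext m
      simp only [Function.comp]
      by_cases hm : m = i
      · rw [hm, Equiv.swap_apply_left]; ext; omega
      by_cases hm' : m = l
      · rw [hm', Equiv.swap_apply_right]; ext; omega
      rw [Equiv.swap_apply_of_ne_of_ne hm hm']
      rcases hv m hm with h | h
      · exact h.2.symm
      · exact absurd (hp (Fin.ext (by omega))) hm'
    rw [this, chain_perm, Equiv.Perm.sign_swap (Ne.symm hli)]
    simp
  · push Not at hex
    refine chain_coh p q hp hq i (fun h => by rw [h] at hpi; omega) fun l hl => ?_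
    rcases hv l hl with h | h
    · exact h.2
    · exact absurd h.2.1 (hex l hl)

theorem sg_coh (n J : ℕ) (x y : Fin (n + 1) → Fin (n + (J + 1)))
    (h : ∃ i, x i ≠ y i ∧ ∀ j, j ≠ i → x j = y j) (hx : sg n J x ≠ 0) (hy : sg n J y ≠ 0) :
    sg n J y = - sg n J x := by
  obtain ⟨i, hi, h⟩ := h
  obtain ⟨j, p, rfl, hp, hgp⟩ := sg_cases n J x hx
  obtain ⟨k, q, rfl, hq, hgq⟩ := sg_cases n J y hy
  rw [sg_good n J j p hgp, sg_good n J k q hgq]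
  rcases lt_trichotomy j.val k.val with hjk | hjk | hjk
  · exact coh_aux n J j k p q hp hq hgp hgq i hjk h
  · have : j = k := Fin.ext hjk
    subst this
    exact chain_coh p q hp hq i (fun h' => hi (congrArg (phi n J j) h'))
      (fun l hl => phi_inj n J j (h l hl))
  · rw [coh_aux n J k j q p hq hp hgq hgp i hjk (fun l hl => (h l hl).symm), neg_neg]

/-- The orientation of the sphere, up to a global sign. -/
def oK (n J : ℕ) (ε : ℤ) (hε : ε = 1 ∨ ε = -1) : CoherentOrientation n (Kc n J) where
  sign := fun x => ε * sg n J x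
  sign_perm := fun x σ => by rw [sg_perm]; ring
  sign_unit := by
    intro x hx hf
    obtain ⟨j, p, rfl, hp, hg⟩ := good_face n J x hx hf
    rw [sg_good n J j p hg]
    rcases chain_unit p hp with h | h <;> rcases hε with h' | h' <;> simp [h, h']
  sign_zero := by
    rintro x (hx | hx)
    · rw [sg, Finset.sum_eq_zero, mul_zero]
      exact fun j _ => chain_noninj _ (phi_inj n J j) x hx
    · have : sg n J x = 0 := by
        by_contra hc
        obtain ⟨j, p, rfl, hp, hg⟩ := sg_cases n J x hc
        exact hx (face_good n J j p hp hg)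
      rw [this, mul_zero]
  coherent := by
    intro x y h hx hy
    rw [sg_coh n J x y h (right_ne_zero_of_mul hx) (right_ne_zero_of_mul hy)]
    ring

/-- The simplicial map. -/
def lab (n J : ℕ) (a : Fin (n + (J + 1))) : Fin (n + 2) :=
  if h : a.val < n then ⟨a.val, by omega⟩
  else if (a.val - n) % 3 = 0 then ⟨n, by omega⟩
  else if (a.val - n) % 3 = 1 then ⟨n + 1, by omega⟩ else 0

theorem lab_simplicial (n J : ℕ) : (Kc n J).IsSimplicialMap (stdSphere n) (lab n J) := by
  rintro s ⟨hs, j, hj, h1, h2⟩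
  refine ⟨hs.image _, fun h => ?_⟩
  have hc : n + 2 ≤ s.card := by
    have := Finset.card_image_le (s := s) (f := lab n J)
    rw [h] at this
    simpa using this
  have hsub : s ⊆ Finset.univ.image (phi n J ⟨j, hj⟩) := by
    intro a ha
    simp only [Finset.mem_image, Finset.mem_univ, true_and]
    rcases h1 a ha with h | h
    · refine ⟨⟨a.val, by omega⟩, Fin.ext ?_⟩
      simp only [phi_val, if_pos h]
    · refine ⟨⟨a.val - j, by omega⟩, Fin.ext ?_⟩
      simp only [phi_val]
      split_ifs <;> omega
  have heq : s = Finset.univ.image (phi n J ⟨j, hj⟩) := by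
    refine Finset.eq_of_subset_of_card_le hsub ?_
    rw [Finset.card_image_of_injective _ (phi_inj n J _)]
    simpa using hc
  have hmem : ∀ c, phi n J ⟨j, hj⟩ c ∈ s := by
    intro c
    rw [heq]
    exact Finset.mem_image_of_mem _ (Finset.mem_univ c)
  rcases h2 with ⟨i, hi⟩ | h | h
  · apply hi
    convert hmem ⟨i.val, by omega⟩ using 1
    ext
    simp [phi_val]
  · have := h _ (hmem ⟨n + 1, by omega⟩)
    simp only [phi_val] at this
    split_ifs at this <;> omega
  · have := h _ (hmem ⟨n, by omega⟩)
    simp only [phi_val] at this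
    split_ifs at this <;> omega

theorem lab_zero (n J : ℕ) (a : Fin (n + (J + 1))) (h1 : n ≤ a.val) (h2 : (a.val - n) % 3 = 2) :
    lab n J a = 0 := by
  unfold lab
  rw [dif_neg (by omega), if_neg (by omega), if_neg (by omega)]

theorem lab_chain (n J : ℕ) (hn : 2 ≤ n) (j : Fin J) (y : Fin (n + 1) → Fin (n + 2)) :
    chain (lab n J ∘ phi n J j) y = if j.val % 3 = 0 then chain id y else 0 := by
  have hlow : (lab n J ∘ phi n J j) 0 = 0 := by
    ext
    simp only [Function.comp, lab, phi_val]
    simp [show 0 < n by omega]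
  have hn0 : (0 : Fin (n + 2)).val = 0 := rfl
  split_ifs with h
  · congr 1
    funext c
    ext
    have hc := c.isLt
    by_cases hcn : c.val < n
    · simp [lab, phi_val, hcn]
    · have hc' : c.val = n ∨ c.val = n + 1 := by omega
      simp only [Function.comp, lab, phi_val, if_neg hcn, id]
      rw [dif_neg (by omega)]
      rcases hc' with hc' | hc'
      · rw [if_pos (by omega)]; simp [hc']
      · rw [if_neg (by omega), if_pos (by omega)]; simp [hc']
  · by_cases h1 : j.val % 3 = 1
    · refine chain_degen _ _ 0 ⟨n + 1, by omega⟩ ?_ ?_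
      · intro h'; have := congrArg Fin.val h'; simp at this
      · rw [hlow]
        refine (lab_zero n J _ ?_ ?_).symm
        · rw [phi_val]; split_ifs <;> simp only at * <;> omega
        · rw [phi_val, if_neg (by simp)]; simp only; omega
    · refine chain_degen _ _ 0 ⟨n, by omega⟩ ?_ ?_
      · intro h'; have := congrArg Fin.val h'; simp at this; omega
      · rw [hlow]
        refine (lab_zero n J _ ?_ ?_).symm
        · rw [phi_val]; split_ifs <;> simp only at * <;> omega
        · rw [phi_val, if_neg (by simp)]; simp only; omega

theorem count_three (D : ℕ) (c : ℤ) :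
    ∑ j ∈ Finset.range (3 * D + 1), (if j % 3 = 0 then c else 0) = (D + 1) * c := by
  induction D with
  | zero => simp
  | succ D ih =>
    rw [show 3 * (D + 1) + 1 = 3 * D + 1 + 1 + 1 + 1 by ring, Finset.sum_range_succ,
      Finset.sum_range_succ, Finset.sum_range_succ, ih, if_neg (by omega), if_neg (by omega),
      if_pos (by omega)]
    push_cast
    ring

theorem lab_degree (n D : ℕ) (hn : 2 ≤ n) (ε : ℤ) (hε : ε = 1 ∨ ε = -1) :
    HasDegree (oK n (3 * D + 1) ε hε) (oStd n) (lab n (3 * D + 1)) (ε * (D + 1)) := by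
  intro y hy
  have hy' : chain id y = 1 := hy
  have h1 : algSum (oK n (3 * D + 1) ε hε).sign (lab n (3 * D + 1)) y =
      ε * ∑ j : Fin (3 * D + 1), algSum (chain (phi n (3 * D + 1) j)) (lab n (3 * D + 1)) y := by
    unfold algSum
    rw [Finset.sum_comm, Finset.mul_sum]
    refine Finset.sum_congr rfl fun x _ => ?_
    split_ifs
    · rfl
    · simp
  rw [h1]
  simp only [chain_push, lab_chain n _ hn, hy']
  rw [Fin.sum_univ_eq_sum_range (fun j => if j % 3 = 0 then (1 : ℤ) else 0), count_three, mul_one]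

/-- For every nonzero `d` and `n ≥ 2` there is a triangulated `n`-sphere with
`3|d| + n - 1` vertices admitting a simplicial degree `d` map to `S^n_{n+2}`. -/
theorem stmt4 (d : ℤ) (hd : d ≠ 0) (n : ℕ) (hn : 2 ≤ n) :
    ∃ K : AbsCx (Fin (3 * d.natAbs + n - 1)),
      K.vertexSet = Set.univ ∧ K.IsSphereTriangulation n ∧
      ∃ (oK : CoherentOrientation n K) (oL : CoherentOrientation n (stdSphere n))
        (f : Fin (3 * d.natAbs + n - 1) → Fin (n + 2)),
        K.IsSimplicialMap (stdSphere n) f ∧ HasDegree oK oL f d := by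
  obtain ⟨D, hD⟩ : ∃ D, d.natAbs = D + 1 := ⟨d.natAbs - 1, by omega⟩
  have hN : 3 * d.natAbs + n - 1 = n + (3 * D + 1 + 1) := by omega
  rw [hN]
  have hε : ∃ ε : ℤ, (ε = 1 ∨ ε = -1) ∧ d = ε * (D + 1) := by
    rcases lt_or_gt_of_ne hd with h | h
    · exact ⟨-1, Or.inr rfl, by omega⟩
    · exact ⟨1, Or.inl rfl, by omega⟩
  obtain ⟨ε, hε, hdε⟩ := hε
  refine ⟨Kc n (3 * D + 1), Kc_vertexSet n _ hn (by omega), Kc_sphere n _ (by omega),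
    oK n _ ε hε, oStd n, lab n _, lab_simplicial n _, ?_⟩
  rw [hdε]
  exact lab_degree n D hn ε hε
end
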